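/- arXiv:math/0007008 — 3 statements merged into one kernel-verified Lean document; each statement's English description precedes it below -/
import Mathlib

section
/- An entire function f : ℂ → ℂ belongs to the Cartwright class if and only if there exist a positive harmonic function h₊ on the upper half-plane {z : Im z > 0} with log⁺|f(z)| ≤ h₊(z) for all z with Im z > 0, and a positive harmonic function h₋ on the lower half-plane {z : Im z < 0} with log⁺|f(z)| ≤ h₋(z) for all z with Im z < 0. -/
open Complex Filter MeasureTheory

noncomputable def logPlus (t : ℝ) : ℝ := max (Real.log t) 0

/-- `h` is harmonic on `U`: real-valued, `C²` on `U`, with vanishing Laplacian. -/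
def HarmonicOn (h : ℂ → ℝ) (U : Set ℂ) : Prop :=
  ContDiffOn ℝ 2 h U ∧ ∀ z ∈ U,
    iteratedFDerivWithin ℝ 2 h U z ![1, 1] +
      iteratedFDerivWithin ℝ 2 h U z ![Complex.I, Complex.I] = 0


section Aux
open InnerProductSpace Metric Real Topology

lemma harm_iff (h : ℂ → ℝ) (U : Set ℂ) (hU : IsOpen U) :
    HarmonicOn h U ↔ HarmonicOnNhd h U := by
  have key : ∀ z ∈ U, iteratedFDerivWithin ℝ 2 h U z ![1, 1] +
      iteratedFDerivWithin ℝ 2 h U z ![Complex.I, Complex.I] = Laplacian.laplacian h z := by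
    intro z hz
    rw [laplacian_eq_iteratedFDeriv_complexPlane, iteratedFDerivWithin_of_isOpen 2 hU hz]
  constructor
  · rintro ⟨h1, h2⟩ z hz
    refine ⟨h1.contDiffAt (hU.mem_nhds hz), ?_⟩
    filter_upwards [hU.mem_nhds hz] with w hw
    rw [← key w hw, h2 w hw]; rfl
  · intro H
    refine ⟨H.contDiffOn, fun z hz => ?_⟩
    rw [key z hz, (H z hz).2.eq_of_nhds]; rfl

lemma harm_comp (h : ℂ → ℝ) (a b z : ℂ) (H : HarmonicAt h (a * z + b)) :
    HarmonicAt (fun w => h (a * w + b)) z := by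
  obtain ⟨ε, h₁ε, h₂ε⟩ := Metric.isOpen_iff.1 (isOpen_setOfPred_harmonicAt (f := h)) _ H
  obtain ⟨F, h₁F, h₂F⟩ := InnerProductSpace.HarmonicOnNhd.exists_analyticOnNhd_ball_re_eq
    (fun _ hy ↦ h₂ε hy)
  have hc : ContinuousAt (fun w : ℂ => a * w + b) z := by fun_prop
  have : (fun w => h (a * w + b)) =ᶠ[𝓝 z] fun w => (F (a * w + b)).re := by
    filter_upwards [hc (Metric.ball_mem_nhds _ h₁ε)] with w hw
    exact (h₂F hw).symm
  rw [harmonicAt_congr_nhds this]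
  apply AnalyticAt.harmonicAt_re
  exact AnalyticAt.fun_comp (h₁F _ (by simp [h₁ε])) (by fun_prop)

lemma logPlus_eq : logPlus = Real.posLog := by
  ext t; simp [logPlus, Real.posLog, max_comm]

lemma u_cont (f : ℂ → ℂ) (hf : Differentiable ℂ f) : Continuous fun z => logPlus ‖f z‖ := by
  rw [logPlus_eq]
  exact Real.continuous_posLog.comp hf.continuous.norm

lemma logPlus_nonneg (t : ℝ) : 0 ≤ logPlus t := le_max_right _ _

lemma u_sub (f : ℂ → ℂ) (hf : Differentiable ℂ f) (c : ℂ) (r : ℝ) (hr : 0 < r) :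
    logPlus ‖f c‖ ≤ circleAverage (fun z => logPlus ‖f z‖) c r := by
  have hci : CircleIntegrable (fun z => logPlus ‖f z‖) c r :=
    (u_cont f hf).continuousOn.circleIntegrable'
  have h0 : 0 ≤ circleAverage (fun z => logPlus ‖f z‖) c r :=
    circleAverage_nonneg_of_nonneg fun x _ => logPlus_nonneg _
  by_cases hc : f c = 0
  · simpa [logPlus, hc] using h0
  have han : AnalyticOnNhd ℂ f (closedBall c |r|) := fun z _ => hf.analyticAt z
  have := AnalyticOnNhd.circleAverage_log_norm hr.ne' han hc
  refine max_le ?_ h0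
  have h2 : circleAverage (Real.log ‖f ·‖) c r ≤ circleAverage (fun z => logPlus ‖f z‖) c r := by
    refine circleAverage_mono ?_ hci fun x _ => le_max_left _ _
    exact MeromorphicOn.circleIntegrable_log_norm (fun z _ => (hf.analyticAt z).meromorphicAt)
  refine le_trans ?_ h2
  rw [this]
  have : 0 ≤ ∑ᶠ u, (MeromorphicOn.divisor f (closedBall c |r|) u : ℝ) * Real.log (r * ‖c - u‖⁻¹) := by
    apply finsum_nonneg
    intro u
    by_cases hu : u ∈ closedBall c |r|
    · apply mul_nonneg
      · exact mod_cast MeromorphicOn.AnalyticOnNhd.divisor_nonneg han u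
      · rcases eq_or_ne u c with rfl | huc
        · simp
        · have : 0 < ‖c - u‖ := norm_pos_iff.2 (sub_ne_zero.2 huc.symm)
          apply Real.log_nonneg
          rw [← div_eq_mul_inv, one_le_div this]
          simpa [abs_of_pos hr, dist_comm u c, dist_eq_norm] using hu
    · simp [hu]
  linarith

/-- strict max principle on the half disc -/
lemma maxP (R : ℝ) (v : ℂ → ℝ) (hv : ContinuousOn v {z | 0 ≤ z.im ∧ ‖z‖ ≤ R})
    (hs : ∀ c : ℂ, 0 < c.im → ‖c‖ < R →
      ∀ᶠ r in 𝓝[>] (0:ℝ), v c ≤ circleAverage v c r)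
    (hb1 : ∀ z : ℂ, z.im = 0 → ‖z‖ ≤ R → v z ≤ 0)
    (hb2 : ∀ z : ℂ, 0 ≤ z.im → ‖z‖ = R → v z ≤ 0) :
    ∀ z : ℂ, 0 ≤ z.im → ‖z‖ ≤ R → v z ≤ 0 := by
  intro z hz1 hz2
  set K : Set ℂ := {z | 0 ≤ z.im ∧ ‖z‖ ≤ R} with hK
  have hKc : IsCompact K := by
    apply (isCompact_closedBall (0:ℂ) R).of_isClosed_subset
    · exact (isClosed_le continuous_const Complex.continuous_im).inter
        (isClosed_le continuous_norm continuous_const)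
    · intro w hw; simpa using hw.2
  have hR : 0 ≤ R := (norm_nonneg z).trans hz2
  have main : ∀ ε > 0, v z ≤ ε * R ^ 2 := by
    intro ε hε
    have hcont : ContinuousOn (fun w => v w + ε * ‖w‖ ^ 2) K := hv.add (by fun_prop)
    obtain ⟨c, hcK, hmax⟩ := hKc.exists_isMaxOn ⟨z, hz1, hz2⟩ hcont
    have hzc : v z + ε * ‖z‖ ^ 2 ≤ v c + ε * ‖c‖ ^ 2 := hmax ⟨hz1, hz2⟩
    have hvc : v c ≤ 0 := by
      rcases hcK.1.eq_or_lt with h0 | h0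
      · exact hb1 c h0.symm hcK.2
      rcases hcK.2.eq_or_lt with h1 | h1
      · exact hb2 c hcK.1 h1
      exfalso
      have hnh : K ∈ 𝓝 c := by
        have : {w : ℂ | 0 < w.im ∧ ‖w‖ < R} ∈ 𝓝 c :=
          ((isOpen_lt continuous_const Complex.continuous_im).inter
            (isOpen_lt continuous_norm continuous_const)).mem_nhds ⟨h0, h1⟩
        exact mem_of_superset this fun w hw => ⟨hw.1.le, hw.2.le⟩
      obtain ⟨r0, hr0, hball⟩ := Metric.nhds_basis_closedBall.mem_iff.1 hnh
      obtain ⟨r, hr, hr1, hr2⟩ := ((hs c h0 h1).and (Ioc_mem_nhdsGT hr0)).exists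
      have hsub : sphere c |r| ⊆ K := by
        rw [abs_of_pos hr1]
        exact (sphere_subset_closedBall.trans (closedBall_subset_closedBall hr2)).trans hball
      have ci1 : CircleIntegrable v c r := (hv.mono hsub).circleIntegrable'
      have hg : HarmonicOnNhd (fun w : ℂ => ((starRingEnd ℂ c) * (2 * w) - (‖c‖:ℂ) ^ 2).re) (closedBall c |r|) := by
        intro w _
        apply AnalyticAt.harmonicAt_re
        fun_prop
      have hga := hg.circleAverage_eq
      have ci2 : CircleIntegrable (fun w : ℂ => ((starRingEnd ℂ c) * (2 * w) - (‖c‖:ℂ) ^ 2).re) c r :=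
        (Continuous.continuousOn (by fun_prop)).circleIntegrable'
      have ci3 : CircleIntegrable (fun w : ℂ => ε * ((starRingEnd ℂ c) * (2 * w) - (‖c‖:ℂ) ^ 2).re) c r :=
        (Continuous.continuousOn (by fun_prop)).circleIntegrable'
      have e1 : ∀ w ∈ sphere c |r|, v w + ε * (((starRingEnd ℂ c) * (2 * w) - (‖c‖:ℂ) ^ 2).re) ≤ v c + ε * ‖c‖ ^ 2 - ε * r ^ 2 := by
        intro w hw
        have h3 : v w + ε * ‖w‖ ^ 2 ≤ v c + ε * ‖c‖ ^ 2 := hmax (hsub hw)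
        have h4 : ‖w - c‖ ^ 2 = r ^ 2 := by
          rw [mem_sphere, dist_eq_norm] at hw; rw [hw, sq_abs]
        have h5 : ((starRingEnd ℂ c) * (2 * w) - (‖c‖:ℂ) ^ 2).re = ‖w‖ ^ 2 - r ^ 2 := by
          rw [← h4]
          simp only [← Complex.normSq_eq_norm_sq, Complex.normSq_apply]
          norm_cast
          simp [← Complex.normSq_eq_norm_sq, Complex.normSq_apply]
          ring
        rw [h5]; linarith
      have h6 := circleAverage_mono_on_of_le_circle (ci1.add ci3) e1
      rw [circleAverage_add ci1 ci3] at h6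
      have h7 := circleAverage_fun_smul (a := ε) (f := fun w : ℂ => ((starRingEnd ℂ c) * (2 * w) - (‖c‖:ℂ) ^ 2).re) (c := c) (R := r)
      simp only [smul_eq_mul] at h7
      rw [h7, hga] at h6
      have h8 : ((starRingEnd ℂ c) * (2 * c) - (‖c‖:ℂ) ^ 2).re = ‖c‖ ^ 2 := by
        norm_cast
        simp [← Complex.normSq_eq_norm_sq, Complex.normSq_apply]
        ring
      rw [h8] at h6
      have : 0 < ε * r ^ 2 := by positivity
      linarith
    have : ‖c‖ ^ 2 ≤ R ^ 2 := by gcongr; exact hcK.2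
    nlinarith [mul_le_mul_of_nonneg_left this hε.le, mul_nonneg hε.le (sq_nonneg ‖z‖)]
  by_contra hcon
  push Not at hcon
  have := main (v z / (2 * (R ^ 2 + 1))) (by positivity)
  have h2 : v z / (2 * (R ^ 2 + 1)) * R ^ 2 < v z := by
    rw [div_mul_eq_mul_div, div_lt_iff₀ (by positivity)]
    nlinarith [mul_nonneg hcon.le (sq_nonneg R)]
  linarith


noncomputable def PI (φ : ℝ → ℝ) (z : ℂ) : ℝ := ∫ t : ℝ, z.im / ((z.re - t) ^ 2 + z.im ^ 2) * φ t

noncomputable def QI (φ : ℝ → ℝ) (z : ℂ) : ℝ := ∫ s : ℝ, φ (z.re + z.im * s) * (1 + s ^ 2)⁻¹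

lemma Q_eq_PI (φ : ℝ → ℝ) (z : ℂ) (hz : 0 < z.im) : QI φ z = PI φ z := by
  set g : ℝ → ℝ := fun t => z.im / ((z.re - t) ^ 2 + z.im ^ 2) * φ t with hg
  have h1 : (∫ s : ℝ, g (z.re + z.im * s)) = |z.im⁻¹| • ∫ t, g t := by
    have := MeasureTheory.Measure.integral_comp_mul_left (fun s => g (z.re + s)) z.im
    rw [this, integral_add_left_eq_self]
  have h2 : QI φ z = z.im * ∫ s : ℝ, g (z.re + z.im * s) := by
    rw [QI, ← integral_const_mul]
    congr 1; ext s
    have : (1 + s ^ 2) ≠ 0 := by positivity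
    have h3 : (z.re - (z.re + z.im * s)) ^ 2 + z.im ^ 2 = z.im ^ 2 * (1 + s ^ 2) := by ring
    simp only [hg]
    rw [h3]
    field_simp
  rw [h2, h1, abs_of_pos (by positivity), smul_eq_mul, ← mul_assoc, mul_inv_cancel₀ hz.ne', one_mul, PI]

lemma Q_cont (φ : ℝ → ℝ) (hφ : Continuous φ) (M : ℝ) (hM : ∀ x, |φ x| ≤ M) : Continuous (QI φ) := by
  apply continuous_of_dominated (bound := fun s => M * (1 + s ^ 2)⁻¹)
  · intro z
    apply Continuous.aestronglyMeasurable
    have : ∀ s : ℝ, 1 + s ^ 2 ≠ 0 := fun s => by positivity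
    fun_prop (disch := assumption)
  · intro z
    refine Eventually.of_forall fun s => ?_
    rw [norm_mul, Real.norm_eq_abs, Real.norm_eq_abs, abs_of_pos (a := (1 + s ^ 2)⁻¹) (by positivity)]
    gcongr
    exact hM _
  · exact integrable_inv_one_add_sq.const_mul M
  · refine Eventually.of_forall fun s => ?_
    fun_prop

lemma Q_real (φ : ℝ → ℝ) (z : ℂ) (hz : z.im = 0) : QI φ z = π * φ z.re := by
  simp only [QI, hz, zero_mul, add_zero]
  rw [integral_const_mul, integral_univ_inv_one_add_sq, mul_comm]

noncomputable def kk (t : ℝ) (z : ℂ) : ℂ := z + (1 + z ^ 2) / (t - z)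

lemma t_sub_norm (t : ℝ) (z : ℂ) : |z.im| ≤ ‖(t:ℂ) - z‖ := by
  have := Complex.abs_im_le_norm ((t:ℂ) - z)
  simpa using this

lemma PI_harm (φ : ℝ → ℝ) (hφ : Integrable fun t : ℝ => φ t / (1 + t ^ 2)) (z : ℂ) (hz : 0 < z.im) :
    HarmonicAt (PI φ) z := by
  set ψ : ℝ → ℂ := fun t => ((φ t / (1 + t ^ 2) : ℝ) : ℂ) with hψ
  have hψi : Integrable ψ := hφ.ofReal
  have kmeas : ∀ w : ℂ, Measurable fun t : ℝ => kk t w := by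
    intro w; unfold kk; fun_prop
  have kbd : ∀ w : ℂ, 0 < w.im → ∀ t : ℝ, ‖kk t w‖ ≤ ‖w‖ + (1 + ‖w‖ ^ 2) / w.im := by
    intro w hw t
    have h1 := t_sub_norm t w
    rw [abs_of_pos hw] at h1
    calc ‖kk t w‖ ≤ ‖w‖ + ‖(1 + w ^ 2) / (t - w)‖ := norm_add_le _ _
      _ ≤ _ := by
        rw [norm_div]
        gcongr
        exact (norm_add_le _ _).trans (by simp)
  have hint : ∀ w : ℂ, 0 < w.im → Integrable fun t : ℝ => ψ t * kk t w := by
    intro w hw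
    exact hψi.mul_bdd (c := ‖w‖ + (1 + ‖w‖ ^ 2) / w.im) (kmeas w).aestronglyMeasurable
      (Eventually.of_forall (kbd w hw))
  have hne : ∀ w : ℂ, 0 < w.im → ∀ t : ℝ, (t:ℂ) - w ≠ 0 := by
    intro w hw t
    have h1 := t_sub_norm t w
    rw [abs_of_pos hw] at h1
    exact norm_pos_iff.1 (hw.trans_le h1)
  have hder : ∀ w : ℂ, 0 < w.im → ∀ t : ℝ, HasDerivAt (kk t)
      (1 + (2 * w * (t - w) + (1 + w ^ 2)) / (t - w) ^ 2) w := by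
    intro w hw t
    have a1 : HasDerivAt (fun w : ℂ => 1 + w ^ 2) (2 * w) w := by
      simpa using (hasDerivAt_pow 2 w).const_add 1
    have a2 : HasDerivAt (fun w : ℂ => (t:ℂ) - w) (-1) w := by
      simpa using (hasDerivAt_id w).const_sub (t:ℂ)
    have := (hasDerivAt_id w).add (a1.div a2 (hne w hw t))
    refine HasDerivAt.congr_deriv (f := kk t) this ?_
    ring
  have hdiff : ∀ w : ℂ, 0 < w.im → DifferentiableAt ℂ (fun w => ∫ t, ψ t * kk t w) w := by
    intro w hw
    set d := w.im / 2 with hd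
    have hd0 : 0 < d := by positivity
    set M := ‖w‖ + d with hM
    have hb : ∀ v ∈ ball w d, d ≤ v.im ∧ ‖v‖ ≤ M := by
      intro v hv
      rw [mem_ball, dist_eq_norm] at hv
      have h1 := (Complex.abs_im_le_norm (v - w)).trans hv.le
      rw [Complex.sub_im] at h1
      have h2 := abs_le.1 h1
      refine ⟨by linarith, ?_⟩
      have : ‖v‖ ≤ ‖w‖ + ‖v - w‖ := by simpa using norm_add_le w (v - w)
      linarith
    have := hasDerivAt_integral_of_dominated_loc_of_deriv_le (μ := volume)
      (F := fun w t => ψ t * kk t w)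
      (F' := fun w (t:ℝ) => ψ t * (1 + (2 * w * (t - w) + (1 + w ^ 2)) / (t - w) ^ 2))
      (x₀ := w) (s := ball w d) (bound := fun t => ‖ψ t‖ * (1 + (2 * M / d + (1 + M ^ 2) / d ^ 2)))
      (ball_mem_nhds w hd0)
      (Eventually.of_forall fun v => hψi.aestronglyMeasurable.mul (kmeas v).aestronglyMeasurable)
      (hint w hw)
      (hψi.aestronglyMeasurable.mul (by apply Measurable.aestronglyMeasurable; fun_prop))
      (Eventually.of_forall fun t v hv => ?_)
      (hψi.norm.mul_const _)
      (Eventually.of_forall fun t v hv => (hder v (hd0.trans_le (hb v hv).1) t).const_mul _)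
    · exact this.2.differentiableAt
    · obtain ⟨b1, b2⟩ := hb v hv
      have hv0 : 0 < v.im := hd0.trans_le b1
      have h1 := t_sub_norm t v
      rw [abs_of_pos hv0] at h1
      have h2 : d ≤ ‖(t:ℂ) - v‖ := b1.trans h1
      rw [norm_mul]
      gcongr
      have e : (2 * v * (t - v) + (1 + v ^ 2)) / (t - v) ^ 2 = 2 * v / (t - v) + (1 + v ^ 2) / (t - v) ^ 2 := by
        have := hne v hv0 t
        field_simp
      rw [e]
      refine (norm_add_le _ _).trans ?_
      rw [norm_one]
      gcongr
      refine (norm_add_le _ _).trans ?_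
      rw [norm_div, norm_div, norm_pow, norm_mul]
      have : ‖1 + v ^ 2‖ ≤ 1 + ‖v‖ ^ 2 := (norm_add_le _ _).trans (by simp)
      simp only [Complex.norm_ofNat]
      have h3 : ‖1 + v ^ 2‖ ≤ 1 + M ^ 2 := this.trans (by gcongr)
      gcongr
  have hopen : IsOpen {w : ℂ | 0 < w.im} := isOpen_lt continuous_const Complex.continuous_im
  have han : AnalyticAt ℂ (fun w => ∫ t, ψ t * kk t w) z :=
    DifferentiableOn.analyticAt (s := {w : ℂ | 0 < w.im})
      (fun w hw => (hdiff w hw).differentiableWithinAt) (hopen.mem_nhds hz)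
  have heq : PI φ =ᶠ[𝓝 z] fun w => (∫ t, ψ t * kk t w).im := by
    filter_upwards [hopen.mem_nhds hz] with w hw
    have h1 := Complex.imCLM.integral_comp_comm (hint w hw)
    simp only [Complex.imCLM_apply] at h1
    rw [← h1, PI]
    congr 1; ext t
    simp only [hψ, Complex.im_ofReal_mul]
    have hk : (kk t w).im = w.im * (1 + t ^ 2) / ((w.re - t) ^ 2 + w.im ^ 2) := by
      have hk1 : kk t w = (1 + t * w) / (t - w) := by
        have := hne w hw t
        unfold kk; field_simp; ring
      have hw' : 0 < w.im := hw
      have : (w.re - t) ^ 2 + w.im ^ 2 ≠ 0 := by positivity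
      have hns : Complex.normSq (t - w) = (w.re - t) ^ 2 + w.im ^ 2 := by
        simp [Complex.normSq_apply]; ring
      rw [hk1, Complex.div_im, hns]
      simp
      field_simp
      ring
    rw [hk]
    have : (1 + t ^ 2) ≠ 0 := by positivity
    field_simp
  rw [harmonicAt_congr_nhds heq]
  exact han.harmonicAt_im


noncomputable def chi (N x : ℝ) : ℝ := max 0 (min 1 (N + 1 - |x|))

lemma chi_cont (N : ℝ) : Continuous (chi N) := by unfold chi; fun_prop
lemma chi_nonneg (N x : ℝ) : 0 ≤ chi N x := le_max_left _ _
lemma chi_le (N x : ℝ) : chi N x ≤ 1 := max_le zero_le_one (min_le_left _ _)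
lemma chi_one (N x : ℝ) (h : |x| ≤ N) : chi N x = 1 := by
  unfold chi; rw [min_eq_left (by linarith)]; simp
lemma chi_zero (N x : ℝ) (h : N + 1 ≤ |x|) : chi N x = 0 := by
  unfold chi; apply max_eq_left; exact (min_le_right _ _).trans (by linarith)

lemma chi_supp (N : ℝ) (φ : ℝ → ℝ) : HasCompactSupport fun x => chi N x * φ x := by
  apply HasCompactSupport.intro (K := closedBall 0 (N + 1)) (isCompact_closedBall _ _)
  intro x hx
  rw [mem_closedBall, dist_zero_right, Real.norm_eq_abs, not_le] at hx
  rw [chi_zero N x hx.le, zero_mul]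

lemma chi_bdd (N : ℝ) (φ : ℝ → ℝ) (hφ : Continuous φ) : ∃ M, ∀ x, |chi N x * φ x| ≤ M :=
  Continuous.bounded_above_of_compact_support ((chi_cont N).mul hφ) (chi_supp N φ)

lemma chi_int (N : ℝ) (φ : ℝ → ℝ) (hφ : Continuous φ) :
    Integrable fun t : ℝ => chi N t * φ t / (1 + t ^ 2) := by
  have h0 : ∀ t : ℝ, 1 + t ^ 2 ≠ 0 := fun t => by positivity
  have h1 : (fun t : ℝ => chi N t * φ t / (1 + t ^ 2)) = fun t => chi N t * (φ t / (1 + t ^ 2)) := by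
    ext t; ring
  rw [h1]
  apply Continuous.integrable_of_hasCompactSupport _ (chi_supp N _)
  exact (chi_cont N).mul (hφ.div (by fun_prop) h0)

lemma PI_int (φ : ℝ → ℝ) (hφ : Integrable fun t : ℝ => φ t / (1 + t ^ 2)) (z : ℂ) (hz : 0 < z.im) :
    Integrable fun t : ℝ => z.im / ((z.re - t) ^ 2 + z.im ^ 2) * φ t := by
  have h1 : (fun t : ℝ => z.im / ((z.re - t) ^ 2 + z.im ^ 2) * φ t) =
      fun t => φ t / (1 + t ^ 2) * (z.im * (1 + t ^ 2) / ((z.re - t) ^ 2 + z.im ^ 2)) := by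
    ext t
    have : 1 + t ^ 2 ≠ 0 := by positivity
    have : (z.re - t) ^ 2 + z.im ^ 2 ≠ 0 := by positivity
    field_simp
  rw [h1]
  apply hφ.mul_bdd (c := z.im * (2 + (1 + 2 * z.re ^ 2) / z.im ^ 2))
  · apply Measurable.aestronglyMeasurable; fun_prop
  · refine Eventually.of_forall fun t => ?_
    have h2 : 0 < (z.re - t) ^ 2 + z.im ^ 2 := by positivity
    rw [Real.norm_eq_abs, abs_of_nonneg (by positivity), mul_div_assoc]
    gcongr
    rw [div_le_iff₀ h2]
    have h3 : (1 + 2 * z.re ^ 2) / z.im ^ 2 * z.im ^ 2 = 1 + 2 * z.re ^ 2 := by field_simp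
    have h4 : 0 ≤ (1 + 2 * z.re ^ 2) / z.im ^ 2 := by positivity
    nlinarith [mul_nonneg h4 (sq_nonneg (z.re - t)), sq_nonneg (2 * z.re - t), sq_nonneg z.im]

lemma harm_avg (v : ℂ → ℝ) (c : ℂ) (h : HarmonicAt v c) :
    ∀ᶠ r in 𝓝[>] (0:ℝ), CircleIntegrable v c r ∧ circleAverage v c r = v c := by
  obtain ⟨r0, hr0, hball⟩ := Metric.nhds_basis_closedBall.mem_iff.1 h.eventually
  filter_upwards [Ioc_mem_nhdsGT hr0] with r hr
  have hs : HarmonicOnNhd v (closedBall c |r|) := by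
    rw [abs_of_pos hr.1]
    exact fun x hx => hball (closedBall_subset_closedBall hr.2 hx)
  exact ⟨(hs.continuousOn.mono sphere_subset_closedBall).circleIntegrable', hs.circleAverage_eq⟩

lemma submean_sub (u g : ℂ → ℝ) (c : ℂ) (hu : Continuous u)
    (hs : ∀ r > 0, u c ≤ circleAverage u c r) (hg : HarmonicAt g c) :
    ∀ᶠ r in 𝓝[>] (0:ℝ), u c - g c ≤ circleAverage (fun z => u z - g z) c r := by
  filter_upwards [harm_avg g c hg, self_mem_nhdsWithin] with r hr hr0
  rw [circleAverage_fun_sub hu.continuousOn.circleIntegrable' hr.1, hr.2]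
  linarith [hs r hr0]

lemma Q_harm (φ : ℝ → ℝ) (hφ : Integrable fun t : ℝ => φ t / (1 + t ^ 2)) (z : ℂ) (hz : 0 < z.im) :
    HarmonicAt (fun w => π⁻¹ * QI φ w) z := by
  have hopen : IsOpen {w : ℂ | 0 < w.im} := isOpen_lt continuous_const Complex.continuous_im
  have heq : (fun w => π⁻¹ * QI φ w) =ᶠ[𝓝 z] (π⁻¹ • PI φ) := by
    filter_upwards [hopen.mem_nhds hz] with w hw
    rw [Q_eq_PI φ w hw]; rfl
  rw [harmonicAt_congr_nhds heq]
  exact (PI_harm φ hφ z hz).const_smul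

lemma Q_nonneg (φ : ℝ → ℝ) (hφ : ∀ x, 0 ≤ φ x) (z : ℂ) : 0 ≤ QI φ z :=
  integral_nonneg fun s => mul_nonneg (hφ _) (by positivity)

lemma fwd_bound (f : ℂ → ℂ) (hf : Differentiable ℂ f) (A B : ℝ) (hA : 0 ≤ A) (hB : 0 ≤ B)
    (hAB : ∀ z, logPlus ‖f z‖ ≤ A * ‖z‖ + B)
    (hi : Integrable (fun x : ℝ => logPlus ‖f (x : ℂ)‖ / (1 + x ^ 2))) (z : ℂ) (hz : 0 < z.im) :
    logPlus ‖f z‖ ≤ π⁻¹ * PI (fun x : ℝ => logPlus ‖f (x : ℂ)‖) z + 2 * A * z.im := by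
  set u0 : ℝ → ℝ := fun x : ℝ => logPlus ‖f (x : ℂ)‖ with hu0
  have hu := u_cont f hf
  have hu0c : Continuous u0 := hu.comp Complex.continuous_ofReal
  have step : ∀ N : ℝ, 0 < N → ‖z‖ ≤ N →
      logPlus ‖f z‖ ≤ π⁻¹ * PI u0 z + (A + B * N⁻¹) * (2 * z.im + (z ^ 2).re * N⁻¹) := by
    intro N hN hzN
    set φ : ℝ → ℝ := fun x => chi N x * u0 x with hφ
    have hφc : Continuous φ := (chi_cont N).mul hu0c
    have hφ0 : ∀ x, 0 ≤ φ x := fun x => mul_nonneg (chi_nonneg _ _) (logPlus_nonneg _)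
    have hφi : Integrable fun t : ℝ => φ t / (1 + t ^ 2) := chi_int N u0 hu0c
    obtain ⟨M, hM⟩ := chi_bdd N u0 hu0c
    have hQc := Q_cont φ hφc M hM
    set ψ : ℂ → ℝ := fun w => (A + B * N⁻¹) * (2 * w.im + (w ^ 2).re * N⁻¹) with hψ
    have hψ' : ψ = fun w : ℂ => (((A + B * N⁻¹ : ℝ) : ℂ) * (-2 * I * w + w ^ 2 * ((N⁻¹ : ℝ) : ℂ))).re := by
      ext w
      rw [Complex.re_ofReal_mul, Complex.add_re, Complex.re_mul_ofReal]
      simp [hψ]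
    have hψh : ∀ w, HarmonicAt ψ w := by
      intro w
      rw [hψ']
      apply AnalyticAt.harmonicAt_re
      fun_prop
    have hψc : Continuous ψ := by rw [hψ']; fun_prop
    have hAB0 : 0 ≤ A + B * N⁻¹ := by positivity
    have hv := maxP N (fun w => logPlus ‖f w‖ - (π⁻¹ * QI φ w + ψ w))
      (Continuous.continuousOn (by fun_prop))
      (fun c hc _ => submean_sub (fun w => logPlus ‖f w‖) (fun w => π⁻¹ * QI φ w + ψ w) c hu
        (fun r hr => u_sub f hf c r hr) ((Q_harm φ hφi c hc).add (hψh c)))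
      ?_ ?_ z hz.le hzN
    · have h1 : QI φ z ≤ PI u0 z := by
        rw [Q_eq_PI φ z hz]
        apply integral_mono (PI_int φ hφi z hz) (PI_int u0 hi z hz)
        intro t
        have : φ t ≤ u0 t := mul_le_of_le_one_left (logPlus_nonneg _) (chi_le _ _)
        simp only
        gcongr
      have h2 : π⁻¹ * QI φ z ≤ π⁻¹ * PI u0 z := by gcongr
      simp only [hψ] at hv
      linarith
    · intro w hw1 hw2
      have hw : w = (w.re : ℂ) := by apply Complex.ext <;> simp [hw1]
      have hre : |w.re| ≤ N := (Complex.abs_re_le_norm w).trans hw2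
      have h1 : φ w.re = logPlus ‖f w‖ := by
        simp only [hφ, hu0]
        rw [chi_one N _ hre, one_mul, ← hw]
      rw [Q_real φ w hw1, h1, ← mul_assoc, inv_mul_cancel₀ Real.pi_ne_zero, one_mul]
      have : 0 ≤ ψ w := by
        simp only [hψ, hw1]
        apply mul_nonneg hAB0
        have : (w ^ 2).re = w.re ^ 2 := by simp [pow_two, hw1]
        rw [this]; positivity
      linarith
    · intro w hw1 hw2
      have h1 := hAB w
      have h2 : 0 ≤ π⁻¹ * QI φ w := mul_nonneg (by positivity) (Q_nonneg φ hφ0 w)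
      have h3 : A * ‖w‖ + B ≤ ψ w := by
        rw [hw2]
        have e1 : A * N + B = (A + B * N⁻¹) * N := by field_simp
        rw [e1]
        simp only [hψ]
        gcongr
        have e2 : w.re ^ 2 + w.im ^ 2 = N ^ 2 := by
          rw [← hw2, ← Complex.normSq_eq_norm_sq, Complex.normSq_apply]; ring
        have e3 : (w ^ 2).re = N ^ 2 - 2 * w.im ^ 2 := by rw [← e2]; simp [pow_two]; ring
        have e4 : w.im ≤ N := by rw [← hw2]; exact Complex.im_le_norm w
        rw [e3]
        have e5 : 2 * w.im + (N ^ 2 - 2 * w.im ^ 2) * N⁻¹ = N + 2 * w.im * (N - w.im) * N⁻¹ := by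
          field_simp; ring
        rw [e5]
        have : 0 ≤ 2 * w.im * (N - w.im) * N⁻¹ := by
          have := sub_nonneg.2 e4
          positivity
        linarith
      linarith
  have hlim : Tendsto (fun N : ℝ => π⁻¹ * PI u0 z + (A + B * N⁻¹) * (2 * z.im + (z ^ 2).re * N⁻¹)) atTop
      (𝓝 (π⁻¹ * PI u0 z + (A + B * 0) * (2 * z.im + (z ^ 2).re * 0))) := by
    have := tendsto_inv_atTop_zero (𝕜 := ℝ)
    exact ((this.const_mul B).const_add A |>.mul ((this.const_mul _).const_add _)).const_add _
  have h9 := ge_of_tendsto hlim (b := logPlus ‖f z‖) (by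
    filter_upwards [eventually_gt_atTop 0, eventually_ge_atTop ‖z‖] with N h1 h2 using step N h1 h2)
  linarith

lemma fwd_upper (f : ℂ → ℂ) (hf : Differentiable ℂ f) (A B : ℝ) (hA : 0 ≤ A) (hB : 0 ≤ B)
    (hAB : ∀ z, logPlus ‖f z‖ ≤ A * ‖z‖ + B)
    (hi : Integrable (fun x : ℝ => logPlus ‖f (x : ℂ)‖ / (1 + x ^ 2))) :
    ∃ h : ℂ → ℝ, HarmonicOnNhd h {z : ℂ | 0 < z.im} ∧
          (∀ z ∈ {z : ℂ | 0 < z.im}, 0 < h z) ∧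
          (∀ z ∈ {z : ℂ | 0 < z.im}, logPlus ‖f z‖ ≤ h z) := by
  refine ⟨fun z => π⁻¹ * PI (fun x : ℝ => logPlus ‖f (x : ℂ)‖) z + (2 * A * z.im + 1), ?_, ?_, ?_⟩
  · intro z hz
    have h1 : HarmonicAt (fun z => π⁻¹ * PI (fun x : ℝ => logPlus ‖f (x : ℂ)‖) z) z :=
      (PI_harm _ hi z hz).const_smul (c := π⁻¹)
    have h2 : HarmonicAt (fun z : ℂ => 2 * A * z.im + 1) z := by
      have e : (fun z : ℂ => 2 * A * z.im + 1) = fun z : ℂ => (((2 * A : ℝ) : ℂ) * z + I).im := by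
        ext w; rw [Complex.add_im, Complex.im_ofReal_mul]; simp
      rw [e]
      apply AnalyticAt.harmonicAt_im
      fun_prop
    exact h1.add h2
  · intro z hz
    have hz' : 0 < z.im := hz
    have : 0 ≤ PI (fun x : ℝ => logPlus ‖f (x : ℂ)‖) z := by
      rw [← Q_eq_PI _ z hz]; exact Q_nonneg _ (fun x => logPlus_nonneg _) z
    positivity
  · intro z hz
    have := fwd_bound f hf A B hA hB hAB hi z hz
    linarith


lemma shift_cont (h : ℂ → ℝ) (hh : HarmonicOnNhd h {z : ℂ | 0 < z.im}) (δ : ℝ) (hδ : 0 < δ) :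
    ContinuousOn (fun w : ℂ => h (w + δ * I)) {w : ℂ | 0 ≤ w.im} := by
  apply hh.continuousOn.comp (by fun_prop)
  intro w hw
  have hw' : 0 ≤ w.im := hw
  simp
  linarith

lemma back_dom (h : ℂ → ℝ) (hh : HarmonicOnNhd h {z : ℂ | 0 < z.im})
    (hpos : ∀ z : ℂ, 0 < z.im → 0 < h z) (δ : ℝ) (hδ : 0 < δ) (N : ℝ) (hN : 0 ≤ N) (z : ℂ) (hz : 0 < z.im) :
    π⁻¹ * QI (fun x : ℝ => chi N x * h (x + δ * I)) z ≤ h (z + δ * I) := by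
  have hsc := shift_cont h hh δ hδ
  have hposδ : ∀ w : ℂ, 0 ≤ w.im → 0 < h (w + δ * I) := by
    intro w hw; apply hpos; simp; linarith
  have hc0 : Continuous fun x : ℝ => h (x + δ * I) := by
    have := hsc.comp_continuous Complex.continuous_ofReal (fun x => by simp)
    exact this
  set φ : ℝ → ℝ := fun x : ℝ => chi N x * h (x + δ * I) with hφ
  have hφc : Continuous φ := (chi_cont N).mul hc0
  have hφ0 : ∀ x, 0 ≤ φ x := fun x => mul_nonneg (chi_nonneg _ _) (hposδ x (by simp)).le
  have hφi : Integrable fun t : ℝ => φ t / (1 + t ^ 2) := chi_int N _ hc0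
  have hφi' : Integrable φ := hφc.integrable_of_hasCompactSupport (chi_supp N _)
  obtain ⟨M, hM⟩ := chi_bdd N _ hc0
  have hQc := Q_cont φ hφc M hM
  have hI0 : 0 ≤ ∫ t, φ t := integral_nonneg hφ0
  apply le_of_forall_pos_le_add
  intro ε hε
  set D := ‖z‖ + 1 + (∫ t, φ t) / ε with hD
  have hD0 : 0 < D := by positivity
  have hzR : ‖z‖ ≤ D + (N + 1) := by
    have : 0 ≤ (∫ t, φ t) / ε := by positivity
    linarith
  have hv := maxP (D + (N + 1)) (fun w => π⁻¹ * QI φ w - (h (w + δ * I) + ε)) ?_ ?_ ?_ ?_ z hz.le hzR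
  · linarith
  · have h1 : Continuous fun w => π⁻¹ * QI φ w := by fun_prop
    have h2 : ContinuousOn (fun w : ℂ => h (w + δ * I)) {z : ℂ | 0 ≤ z.im ∧ ‖z‖ ≤ D + (N + 1)} :=
      hsc.mono fun w hw => hw.1
    exact h1.continuousOn.sub (h2.add continuousOn_const)
  · intro c hc _
    have h1 : HarmonicAt (fun w : ℂ => h (w + δ * I)) c := by
      have := harm_comp h 1 (δ * I) c (hh _ (by simp; linarith))
      simpa using this
    have h2 : HarmonicAt (fun w => π⁻¹ * QI φ w - (h (w + δ * I) + ε)) c :=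
      (Q_harm φ hφi c hc).sub (h1.add (harmonicAt_const ε))
    filter_upwards [harm_avg _ c h2] with r hr
    exact hr.2.ge
  · intro w hw _
    have hw' : w = (w.re : ℂ) := by apply Complex.ext <;> simp [hw]
    rw [Q_real φ w hw, ← mul_assoc, inv_mul_cancel₀ Real.pi_ne_zero, one_mul]
    have h1 : φ w.re ≤ h (w.re + δ * I) :=
      mul_le_of_le_one_left (hposδ _ (by simp)).le (chi_le _ _)
    rw [← hw'] at h1
    linarith
  · intro w hw hwR
    have hp := hposδ w hw
    suffices π⁻¹ * QI φ w ≤ ε by linarith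
    rcases hw.eq_or_lt with h0 | h0
    · have hw' : w = (w.re : ℂ) := by apply Complex.ext <;> simp [← h0]
      have h1 : |w.re| = D + (N + 1) := by
        rw [← hwR]; conv_rhs => rw [hw']
        simp
      rw [Q_real φ w h0.symm]
      have : φ w.re = 0 := by simp only [hφ]; rw [chi_zero N _ (by linarith), zero_mul]
      rw [this]; simp; exact hε.le
    · have h1 : QI φ w ≤ D⁻¹ * ∫ t, φ t := by
        rw [Q_eq_PI φ w h0, ← integral_const_mul]
        apply integral_mono (PI_int φ hφi w h0) (hφi'.const_mul _)
        intro t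
        simp only
        by_cases ht : N + 1 ≤ |t|
        · have : φ t = 0 := by simp only [hφ]; rw [chi_zero N _ ht, zero_mul]
          rw [this]; simp
        · apply mul_le_mul_of_nonneg_right _ (hφ0 t)
          push Not at ht
          have h2 : D ≤ ‖w - t‖ := by
            have := norm_sub_norm_le w (t:ℂ)
            rw [hwR, Complex.norm_real, Real.norm_eq_abs] at this
            linarith
          have h3 : ‖w - t‖ ^ 2 = (w.re - t) ^ 2 + w.im ^ 2 := by
            rw [← Complex.normSq_eq_norm_sq, Complex.normSq_apply]; simp; ring
          have h4 : w.im ≤ ‖w - t‖ := by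
            have := Complex.im_le_norm (w - t); simpa using this
          rw [← h3, inv_eq_one_div, div_le_div_iff₀ (pow_pos (hD0.trans_le h2) 2) hD0]
          nlinarith
      have h2 : D⁻¹ * ∫ t, φ t ≤ ε := by
        rw [inv_mul_le_iff₀ hD0, ← div_le_iff₀ hε]
        linarith [norm_nonneg z]
      have h3 : π⁻¹ ≤ 1 := inv_le_one_of_one_le₀ (by linarith [Real.pi_gt_three])
      have h4 := Q_nonneg φ hφ0 w
      nlinarith

lemma back_line (u h : ℂ → ℝ) (hu : Continuous u) (hu0 : ∀ z, 0 ≤ u z) (hh : HarmonicOnNhd h {z : ℂ | 0 < z.im})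
    (hpos : ∀ z : ℂ, 0 < z.im → 0 < h z) (huh : ∀ z : ℂ, 0 < z.im → u z ≤ h z)
    (δ : ℝ) (hδ : 0 < δ) (N : ℝ) (hN : 0 ≤ N) (s : ℝ) (hs : 0 < s) :
    (∫ x in (-N)..N, u (x + δ * I) * (s / (x ^ 2 + s ^ 2))) ≤ π * h ((s + δ : ℝ) * I) := by
  have hz : 0 < ((s : ℂ) * I).im := by simpa using hs
  have h1 := back_dom h hh hpos δ hδ N hN (s * I) hz
  have hsc := shift_cont h hh δ hδ
  have hc0 : Continuous fun x : ℝ => h (x + δ * I) := by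
    have := hsc.comp_continuous Complex.continuous_ofReal (fun x => by simp)
    exact this
  have hpx : ∀ x : ℝ, 0 < ((x:ℂ) + δ * I).im := by intro x; simpa using hδ
  rw [Q_eq_PI _ _ hz, inv_mul_le_iff₀ Real.pi_pos] at h1
  have e : (s : ℂ) * I + δ * I = (s + δ : ℝ) * I := by push_cast; ring
  rw [e] at h1
  refine le_trans ?_ h1
  have hint := PI_int _ (chi_int N _ hc0) (s * I) hz
  rw [intervalIntegral.integral_of_le (by linarith)]
  refine le_trans (setIntegral_mono_on ?_ hint.integrableOn measurableSet_Ioc ?_) (setIntegral_le_integral hint ?_)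
  · have h0 : ∀ x : ℝ, x ^ 2 + s ^ 2 ≠ 0 := fun x => by positivity
    have hc : Continuous fun x : ℝ => u (x + δ * I) * (s / (x ^ 2 + s ^ 2)) := by
      fun_prop (disch := exact h0 _)
    exact (hc.continuousOn.integrableOn_compact isCompact_Icc).mono_set Set.Ioc_subset_Icc_self
  · intro x hx
    have : |x| ≤ N := abs_le.2 ⟨hx.1.le, hx.2⟩
    rw [chi_one N x this]
    have := huh _ (hpx x)
    simp
    rw [mul_comm]
    gcongr
  · refine Eventually.of_forall fun t => ?_
    have := hpos _ (hpx t)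
    have := chi_nonneg N t
    simp only [Pi.zero_apply]
    positivity

lemma harnack (h : ℂ → ℝ) (hh : HarmonicOnNhd h {z : ℂ | 0 < z.im})
    (hpos : ∀ z : ℂ, 0 < z.im → 0 < h z) (Y : ℝ) (hY : 1 ≤ Y) :
    h (Y * I) ≤ 4 * Y * h I := by
  have hsub : closedBall ((Y:ℂ) * I) (Y - 1 / 2) ⊆ {z : ℂ | 0 < z.im} := by
    intro z hz
    rw [mem_closedBall, dist_eq_norm] at hz
    have := (abs_le.1 ((Complex.abs_im_le_norm _).trans hz)).1
    simp at this ⊢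
    linarith
  have hn : ‖I - (Y:ℂ) * I‖ = Y - 1 := by
    have : I - (Y:ℂ) * I = ((1 - Y : ℝ) : ℂ) * I := by push_cast; ring
    rw [this, norm_mul, Complex.norm_I, mul_one, Complex.norm_real, Real.norm_eq_abs, abs_of_nonpos (by linarith)]
    ring
  have hw : I ∈ ball ((Y:ℂ) * I) (Y - 1 / 2) := by
    rw [mem_ball, dist_eq_norm, hn]; linarith
  have hhb : HarmonicOnNhd h (closedBall ((Y:ℂ) * I) (Y - 1 / 2)) := hh.mono hsub
  have h1 := hhb.circleAverage_re_herglotzRieszKernel_smul hw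
  have habs : |Y - 1 / 2| = Y - 1 / 2 := abs_of_nonneg (by linarith)
  have h2 := (hhb.mono (t := closedBall ((Y:ℂ) * I) |Y - 1 / 2|) (by rw [habs])).circleAverage_eq
  have hcs : ContinuousOn h (sphere ((Y:ℂ) * I) |Y - 1 / 2|) := by
    rw [habs]; exact hhb.continuousOn.mono sphere_subset_closedBall
  set k : ℝ := (Y - 1 / 2 - (Y - 1)) / (Y - 1 / 2 + (Y - 1)) with hk
  have h3 : circleAverage (k • h) ((Y:ℂ) * I) (Y - 1 / 2) ≤
      circleAverage ((re ∘ herglotzRieszKernel ((Y:ℂ) * I) I) • h) ((Y:ℂ) * I) (Y - 1 / 2) := by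
    apply circleAverage_mono
    · exact (hcs.const_smul k).circleIntegrable'
    · apply ContinuousOn.circleIntegrable'
      exact (Complex.continuous_re.comp_continuousOn (continuousOn_herglotzRieszKernel_sphere hw)).smul hcs
    · intro x hx
      rw [habs] at hx
      have h4 := le_re_herglotzRieszKernel hx hw
      rw [hn] at h4
      simp only [Pi.smul_apply, Pi.smul_apply', smul_eq_mul, Function.comp_apply, herglotzRieszKernel_def]
      exact mul_le_mul_of_nonneg_right h4 (hpos x (hsub (sphere_subset_closedBall hx))).le
  rw [h1, circleAverage_smul, h2, smul_eq_mul] at h3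
  have hk' : k = 1 / (4 * Y - 3) := by rw [hk]; rw [div_eq_div_iff] <;> nlinarith
  rw [hk', one_div, inv_mul_le_iff₀ (by linarith)] at h3
  have := hpos I (by simp)
  nlinarith

lemma back_int (u h : ℂ → ℝ) (hu : Continuous u) (hu0 : ∀ z, 0 ≤ u z) (hh : HarmonicOnNhd h {z : ℂ | 0 < z.im})
    (hpos : ∀ z : ℂ, 0 < z.im → 0 < h z) (huh : ∀ z : ℂ, 0 < z.im → u z ≤ h z) :
    Integrable (fun x : ℝ => u x / (1 + x ^ 2)) := by
  have h0 : ∀ x : ℝ, x ^ 2 + 1 ^ 2 ≠ 0 := fun x => by positivity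
  have h0' : ∀ x : ℝ, 1 + x ^ 2 ≠ 0 := fun x => by positivity
  have key : ∀ N : ℝ, 0 ≤ N → (∫ x in (-N)..N, u x * (1 / (x ^ 2 + 1 ^ 2))) ≤ π * h I := by
    intro N hN
    have hJ : Continuous fun δ : ℝ => ∫ x in (-N)..N, u (x + δ * I) * (1 / (x ^ 2 + 1 ^ 2)) := by
      apply intervalIntegral.continuous_parametric_intervalIntegral_of_continuous'
      have hcc : Continuous fun p : ℝ × ℝ => u ((p.2 : ℂ) + p.1 * I) * (1 / (p.2 ^ 2 + 1 ^ 2)) :=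
        (hu.comp (by fun_prop)).mul (continuous_const.div (by fun_prop) (fun p => h0 p.2))
      exact hcc
    have hI : ContinuousAt (fun δ : ℝ => π * h ((1 + δ : ℝ) * I)) 0 := by
      have h1 : ContinuousAt h (((1 + 0 : ℝ) : ℂ) * I) := (hh _ (by simp)).1.continuousAt
      have : ContinuousAt (fun δ : ℝ => h ((1 + δ : ℝ) * I)) 0 :=
        ContinuousAt.comp (f := fun δ : ℝ => ((1 + δ : ℝ) : ℂ) * I) h1 (by fun_prop)
      exact this.const_mul π
    have := le_of_tendsto_of_tendsto (b := 𝓝[>] (0:ℝ)) (hJ.continuousAt.tendsto.mono_left nhdsWithin_le_nhds)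
      (hI.tendsto.mono_left nhdsWithin_le_nhds) (by
        filter_upwards [self_mem_nhdsWithin] with δ hδ
        exact back_line u h hu hu0 hh hpos huh δ hδ N hN 1 one_pos)
    simpa using this
  have hc : Continuous fun x : ℝ => u x / (1 + x ^ 2) := by fun_prop (disch := exact h0' _)
  apply integrable_of_intervalIntegral_norm_bounded (π * h I) (l := atTop) (a := fun N : ℝ => -N) (b := fun N => N)
  · intro N
    exact (hc.continuousOn.integrableOn_compact isCompact_Icc).mono_set Set.Ioc_subset_Icc_self
  · exact tendsto_neg_atTop_atBot
  · exact tendsto_id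
  · filter_upwards [eventually_ge_atTop 0] with N hN
    refine le_trans (le_of_eq ?_) (key N hN)
    congr 1; ext x
    rw [Real.norm_eq_abs, abs_of_nonneg (div_nonneg (hu0 _) (by positivity))]
    ring

lemma back_J (u h : ℂ → ℝ) (hu : Continuous u) (hu0 : ∀ z, 0 ≤ u z) (hh : HarmonicOnNhd h {z : ℂ | 0 < z.im})
    (hpos : ∀ z : ℂ, 0 < z.im → 0 < h z) (huh : ∀ z : ℂ, 0 < z.im → u z ≤ h z)
    (S : ℝ) (hS : 1 ≤ S) (y : ℝ) (hy : 0 < y) (hyS : y ≤ S) :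
    (∫ x in (-S)..S, u (x + y * I)) ≤ 16 * π * S ^ 2 * h I := by
  have h1 := back_line u h hu hu0 hh hpos huh y hy S (by linarith) S (by linarith)
  have h2 := harnack h hh hpos (S + y) (by linarith)
  have h0 : ∀ x : ℝ, x ^ 2 + S ^ 2 ≠ 0 := fun x => by positivity
  have h3 : (∫ x in (-S)..S, u (x + y * I)) ≤ ∫ x in (-S)..S, (2 * S) * (u (x + y * I) * (S / (x ^ 2 + S ^ 2))) := by
    apply intervalIntegral.integral_mono_on (by linarith)
    · exact Continuous.intervalIntegrable (by fun_prop) _ _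
    · apply Continuous.intervalIntegrable
      fun_prop (disch := exact h0 _)
    · intro x hx
      have e : (2 * S) * (u (x + y * I) * (S / (x ^ 2 + S ^ 2))) = u (x + y * I) * (2 * S ^ 2 / (x ^ 2 + S ^ 2)) := by ring
      rw [e]
      apply le_mul_of_one_le_right (hu0 _)
      rw [one_le_div (by positivity)]
      nlinarith [hx.1, hx.2]
  rw [intervalIntegral.integral_const_mul] at h3
  have hI := hpos I (by simp)
  calc _ ≤ _ := h3
    _ ≤ 2 * S * (π * h ((S + y : ℝ) * I)) := by gcongr
    _ ≤ 2 * S * (π * (4 * (S + S) * h I)) := by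
      have : h ((S + y : ℝ) * I) ≤ 4 * (S + S) * h I := h2.trans (by gcongr)
      gcongr
    _ = _ := by ring


lemma area_mean (u : ℂ → ℝ) (hu : Continuous u)
    (hs : ∀ c r, 0 < r → u c ≤ circleAverage u c r) (z : ℂ) (R : ℝ) (hR : 0 < R) :
    π * R ^ 2 * u z ≤ ∫ w in ball (0:ℂ) R, u (z + w) := by
  rw [← integral_indicator measurableSet_ball, ← Complex.integral_comp_polarCoord_symm]
  have hsub : Set.Ioo 0 R ×ˢ Set.Ioo (-π) π ⊆ polarCoord.target := by
    rw [polarCoord_target]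
    exact Set.prod_mono (fun x hx => hx.1) subset_rfl
  set F : ℝ × ℝ → ℝ := fun p => p.1 * u (circleMap z p.1 p.2) with hF
  have hFc : Continuous F := by
    simp only [hF, circleMap]; fun_prop
  have e1 : (∫ p in polarCoord.target, p.1 • (ball (0:ℂ) R).indicator (fun w => u (z + w)) (Complex.polarCoord.symm p))
      = ∫ p in Set.Ioo 0 R ×ˢ Set.Ioo (-π) π, F p := by
    have hm : MeasurableSet (Set.Ioo (0:ℝ) R ×ˢ Set.Ioo (-π) π) := measurableSet_Ioo.prod measurableSet_Ioo
    have hsub' := Set.inter_eq_self_of_subset_right hsub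
    conv_rhs => rw [← hsub']
    rw [← setIntegral_indicator hm]
    apply setIntegral_congr_fun polarCoord.open_target.measurableSet
    intro p hp
    rw [polarCoord_target] at hp
    have hp1 : 0 < p.1 := hp.1
    have e : Complex.polarCoord.symm p = circleMap 0 p.1 p.2 := by
      rw [Complex.polarCoord_symm_apply, circleMap, Complex.exp_mul_I]; push_cast; ring
    have hn : ‖circleMap 0 p.1 p.2‖ = p.1 := by simp [abs_of_pos hp1]
    simp only [e]
    by_cases h : p.1 < R
    · rw [Set.indicator_of_mem, Set.indicator_of_mem]
      · simp [hF, circleMap]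
      · exact ⟨⟨hp1, h⟩, hp.2⟩
      · rw [mem_ball_zero_iff, hn]; exact h
    · rw [Set.indicator_of_notMem, Set.indicator_of_notMem]
      · simp
      · exact fun hh => h hh.1.2
      · rw [mem_ball_zero_iff, hn]; exact h
  rw [e1]
  have hFi : IntegrableOn F (Set.Ioo 0 R ×ˢ Set.Ioo (-π) π) :=
    (hFc.continuousOn.integrableOn_compact (isCompact_Icc.prod isCompact_Icc)).mono_set
      (Set.prod_mono Set.Ioo_subset_Icc_self Set.Ioo_subset_Icc_self)
  rw [Measure.volume_eq_prod] at hFi ⊢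
  rw [setIntegral_prod F hFi]
  have e2 : ∀ r, (∫ θ in Set.Ioo (-π) π, F (r, θ)) = 2 * π * r * circleAverage u z r := by
    intro r
    rw [← integral_Ioc_eq_integral_Ioo, ← intervalIntegral.integral_of_le (by linarith [Real.pi_pos])]
    simp only [hF]
    rw [intervalIntegral.integral_const_mul, circleAverage_eq_integral_add (-π), smul_eq_mul]
    have : (∫ θ in (0:ℝ)..2 * π, u (circleMap z r (θ + -π))) = ∫ θ in (-π)..π, u (circleMap z r θ) := by
      rw [intervalIntegral.integral_comp_add_right (fun θ => u (circleMap z r θ))]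
      congr 1 <;> ring
    rw [this]
    have := Real.pi_ne_zero
    field_simp
  have e3 : (∫ r in Set.Ioo 0 R, 2 * π * u z * r) = π * R ^ 2 * u z := by
    rw [← integral_Ioc_eq_integral_Ioo, ← intervalIntegral.integral_of_le hR.le,
      intervalIntegral.integral_const_mul, integral_id]
    ring
  rw [← e3]
  apply setIntegral_mono_on
  · exact (Continuous.continuousOn (by fun_prop)).integrableOn_compact isCompact_Icc |>.mono_set Set.Ioo_subset_Icc_self
  · rw [IntegrableOn, ← Measure.prod_restrict] at hFi
    exact hFi.integral_prod_left
  · exact measurableSet_Ioo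
  · intro r hr
    rw [e2]
    have := hs z r hr.1
    have h2 : 0 ≤ 2 * π * r := by have := hr.1; positivity
    nlinarith

lemma back_growth (u h k : ℂ → ℝ) (hu : Continuous u) (hu0 : ∀ z, 0 ≤ u z)
    (hs : ∀ c r, 0 < r → u c ≤ circleAverage u c r)
    (hh : HarmonicOnNhd h {z : ℂ | 0 < z.im})
    (hpos : ∀ z : ℂ, 0 < z.im → 0 < h z) (huh : ∀ z : ℂ, 0 < z.im → u z ≤ h z)
    (hk : HarmonicOnNhd k {z : ℂ | 0 < z.im})
    (kpos : ∀ z : ℂ, 0 < z.im → 0 < k z) (huk : ∀ z : ℂ, 0 < z.im → u (-z) ≤ k z) (z : ℂ) :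
    u z ≤ 256 * (h I + k I) * (‖z‖ + 1) := by
  set R := ‖z‖ + 1 with hRdef
  have hR : 1 ≤ R := by have := norm_nonneg z; linarith
  set S := 2 * R with hSdef
  have hS : 1 ≤ S := by linarith
  set H := h I + k I with hH
  have hI0 := hpos I (by simp)
  have kI0 := kpos I (by simp)
  have hJ : ∀ y : ℝ, y ≠ 0 → |y| ≤ S → (∫ x in (-S)..S, u (x + y * I)) ≤ 16 * π * S ^ 2 * H := by
    intro y hy hyS
    have hyS' := abs_le.1 hyS
    rcases lt_or_gt_of_ne hy with h0 | h0
    · have := back_J (fun w => u (-w)) k (by fun_prop) (fun _ => hu0 _) hk kpos huk S hS (-y) (by linarith) (by linarith)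
      have e : (∫ x in (-S)..S, u (-((x:ℂ) + (-y : ℝ) * I))) = ∫ x in (-S)..S, u (x + y * I) := by
        have := intervalIntegral.integral_comp_neg (a := -S) (b := S) (fun x : ℝ => u (x + y * I))
        rw [neg_neg] at this
        rw [← this]
        congr 1; ext x; congr 1; push_cast; ring
      rw [← e]
      refine this.trans ?_
      have : k I ≤ H := by linarith
      gcongr
    · refine (back_J u h hu hu0 hh hpos huh S hS y h0 hyS'.2).trans ?_
      have : h I ≤ H := by linarith
      gcongr
  have h1 := area_mean u hu hs z R (by linarith)
  set T : Set (ℝ × ℝ) := Set.Ioc (-S) S ×ˢ Set.Ioc (-S) S with hT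
  set G : ℝ × ℝ → ℝ := fun p => u (p.1 + p.2 * I) with hG
  have hGc : Continuous G := by simp only [hG]; fun_prop
  have hGi : IntegrableOn G T :=
    (hGc.continuousOn.integrableOn_compact (isCompact_Icc.prod isCompact_Icc)).mono_set
      (Set.prod_mono Set.Ioc_subset_Icc_self Set.Ioc_subset_Icc_self)
  have h2 : (∫ w in ball (0:ℂ) R, u (z + w)) = ∫ w in ball z R, u w := by
    rw [← integral_indicator measurableSet_ball, ← integral_indicator measurableSet_ball,
      ← integral_add_left_eq_self ((ball z R).indicator fun w => u w) z]
    congr 1; ext w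
    by_cases hw : ‖w‖ < R
    · rw [Set.indicator_of_mem (by simpa using hw), Set.indicator_of_mem (by simpa using hw)]
    · rw [Set.indicator_of_notMem (by simpa using hw), Set.indicator_of_notMem (by simpa using hw)]
  have h3 : (∫ w in ball z R, u w) ≤ ∫ p in T, G p := by
    have e := Complex.volume_preserving_equiv_real_prod.setIntegral_preimage_emb
      Complex.measurableEquivRealProd.measurableEmbedding G T
    have e' : ∀ w : ℂ, G (Complex.measurableEquivRealProd w) = u w := by
      intro w; simp [hG, Complex.measurableEquivRealProd_apply]
    simp only [e'] at e
    rw [← e]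
    apply setIntegral_mono_set
    · have := (Complex.volume_preserving_equiv_real_prod.integrableOn_comp_preimage
        Complex.measurableEquivRealProd.measurableEmbedding (f := G) (s := T)).2 hGi
      refine this.congr_fun (fun w _ => e' w) ?_
      exact Complex.measurableEquivRealProd.measurable (measurableSet_Ioc.prod measurableSet_Ioc)
    · exact Eventually.of_forall hu0
    · apply LE.le.eventuallyLE
      intro w hw
      rw [mem_ball, dist_eq_norm] at hw
      have hw2 : ‖w‖ < S := by
        have := norm_sub_norm_le w z
        linarith
      have a1 := abs_lt.1 ((Complex.abs_re_le_norm w).trans_lt hw2)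
      have a2 := abs_lt.1 ((Complex.abs_im_le_norm w).trans_lt hw2)
      simp only [Set.mem_preimage, Complex.measurableEquivRealProd_apply, hT]
      exact ⟨⟨a1.1, a1.2.le⟩, ⟨a2.1, a2.2.le⟩⟩
  have h4 : (∫ p in T, G p) ≤ 2 * S * (16 * π * S ^ 2 * H) := by
    have hGi' : Integrable G ((volume.restrict (Set.Ioc (-S) S)).prod (volume.restrict (Set.Ioc (-S) S))) := by
      rw [IntegrableOn, hT, Measure.volume_eq_prod, ← Measure.prod_restrict] at hGi
      exact hGi
    rw [hT, Measure.volume_eq_prod, ← Measure.prod_restrict, integral_prod_symm G hGi']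
    have e : 2 * S * (16 * π * S ^ 2 * H) = ∫ y in Set.Ioc (-S) S, 16 * π * S ^ 2 * H := by
      rw [setIntegral_const, smul_eq_mul]
      congr 1
      rw [measureReal_def, Real.volume_Ioc, ENNReal.toReal_ofReal (by linarith)]; ring
    rw [e]
    apply setIntegral_mono_ae_restrict
    · exact hGi'.integral_prod_right
    · exact integrableOn_const (by simp)
    · have hne : ∀ᵐ y ∂(volume.restrict (Set.Ioc (-S) S)), y ≠ (0:ℝ) :=
        ae_restrict_of_ae (Measure.ae_ne volume 0)
      filter_upwards [hne, ae_restrict_mem measurableSet_Ioc] with y hy hyS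
      have := hJ y hy (abs_le.2 ⟨hyS.1.le, hyS.2⟩)
      rw [intervalIntegral.integral_of_le (by linarith)] at this
      exact this
  have h5 : π * R ^ 2 * u z ≤ π * R ^ 2 * (256 * H * R) := by
    rw [h2] at h1
    refine (h1.trans (h3.trans h4)).trans (le_of_eq ?_)
    rw [hSdef]; ring
  exact le_of_mul_le_mul_left h5 (by positivity)

end Aux

theorem stmt0 (f : ℂ → ℂ) (hf : Differentiable ℂ f) :
    ((∃ A B : ℝ, ∀ z : ℂ, Real.log ‖f z‖ ≤ A * ‖z‖ + B) ∧
        Integrable (fun x : ℝ => logPlus ‖f (x : ℂ)‖ / (1 + x ^ 2))) ↔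
      ((∃ h : ℂ → ℝ, HarmonicOn h {z : ℂ | 0 < z.im} ∧
          (∀ z ∈ {z : ℂ | 0 < z.im}, 0 < h z) ∧
          (∀ z ∈ {z : ℂ | 0 < z.im}, logPlus ‖f z‖ ≤ h z)) ∧
        (∃ h : ℂ → ℝ, HarmonicOn h {z : ℂ | z.im < 0} ∧
          (∀ z ∈ {z : ℂ | z.im < 0}, 0 < h z) ∧
          (∀ z ∈ {z : ℂ | z.im < 0}, logPlus ‖f z‖ ≤ h z))) := by
  have hUo : IsOpen {z : ℂ | 0 < z.im} := isOpen_lt continuous_const Complex.continuous_im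
  have hLo : IsOpen {z : ℂ | z.im < 0} := isOpen_lt Complex.continuous_im continuous_const
  constructor
  · rintro ⟨⟨A, B, hAB⟩, hi⟩
    have hb : ∀ z, logPlus ‖f z‖ ≤ max A 0 * ‖z‖ + max B 0 := by
      intro z
      apply max_le
      · have h1 : A * ‖z‖ ≤ max A 0 * ‖z‖ := by gcongr; exact le_max_left _ _
        linarith [hAB z, le_max_left B 0]
      · positivity
    constructor
    · obtain ⟨h, h1, h2, h3⟩ := fwd_upper f hf _ _ (le_max_right A 0) (le_max_right B 0) hb hi
      exact ⟨h, (harm_iff h _ hUo).2 h1, h2, h3⟩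
    · obtain ⟨h, h1, h2, h3⟩ := fwd_upper (fun z => f (-z)) (by fun_prop) _ _ (le_max_right A 0) (le_max_right B 0)
        (fun z => by simpa using hb (-z)) (by simpa using hi.comp_neg)
      refine ⟨fun z => h (-z), (harm_iff _ _ hLo).2 ?_, ?_, ?_⟩
      · intro z hz
        have hz' : z.im < 0 := hz
        have := harm_comp h (-1) 0 z (h1 _ (by simpa using hz'))
        simpa using this
      · intro z hz
        have hz' : z.im < 0 := hz
        exact h2 (-z) (by simpa using hz')
      · intro z hz
        have hz' : z.im < 0 := hz
        simpa using h3 (-z) (by simpa using hz')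
  · rintro ⟨⟨h, h1, h2, h3⟩, ⟨k, k1, k2, k3⟩⟩
    rw [harm_iff _ _ hUo] at h1
    rw [harm_iff _ _ hLo] at k1
    have hg := back_growth (fun z => logPlus ‖f z‖) h (fun z => k (-z)) (u_cont f hf) (fun z => logPlus_nonneg _)
      (u_sub f hf) h1 h2 h3 (fun z hz => by
        have hz' : 0 < z.im := hz
        have := harm_comp k (-1) 0 z (k1 _ (by simpa using hz'))
        simpa using this) (fun z hz => k2 (-z) (by simpa using hz)) (fun z hz => k3 (-z) (by simpa using hz))
    refine ⟨⟨256 * (h I + k (-I)), 256 * (h I + k (-I)), fun z => ?_⟩,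
      back_int (fun z => logPlus ‖f z‖) h (u_cont f hf) (fun z => logPlus_nonneg _) h1 h2 h3⟩
    have := hg z
    have h4 : Real.log ‖f z‖ ≤ logPlus ‖f z‖ := le_max_left _ _
    linarith
end

section
/- Every entire function of the Krein class belongs to the Cartwright class; that is, if f is an entire function of the Krein class, then there are constants A, B with log|f(z)| ≤ A|z| + B for all z ∈ ℂ, and ∫_ℝ log⁺|f(x)|/(1+x²) dx < ∞. -/
open Complex Filter MeasureTheory

/-- `f` is an entire function of the Krein class, with (real, simple) zeros
enumerated by the sequence `lam`. -/
def KreinClass (f : ℂ → ℂ) (lam : ℕ → ℝ) : Prop :=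
  Differentiable ℂ f ∧
  Function.Injective lam ∧
  (∀ z : ℂ, f z = 0 ↔ ∃ n, z = (lam n : ℂ)) ∧
  (∀ n, deriv f (lam n) ≠ 0) ∧
  Summable (fun n => 1 / ‖deriv f (lam n)‖) ∧
  ∀ z : ℂ, f z ≠ 0 →
    Summable (fun n => ‖1 / (deriv f (lam n) * (z - (lam n : ℂ)))‖) ∧
    1 / f z = ∑' n, 1 / (deriv f (lam n) * (z - (lam n : ℂ)))


lemma kr_G (p : ℕ → ℝ) (lam : ℕ → ℝ) (hp : ∀ n, 0 ≤ p n) (hs : Summable p) :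
    ∃ g : ℂ → ℂ, DifferentiableOn ℂ g {z | 0 < z.im} ∧ ∀ z : ℂ, 0 < z.im →
      0 ≤ (g z).re ∧ HasSum (fun n => (p n : ℂ) * (I / (z - lam n))) (g z) := by
  have hne : ∀ z : ℂ, 0 < z.im → ∀ n, z - lam n ≠ 0 := by
    intro z hz n h
    have := congrArg Complex.im h
    simp at this
    linarith
  have hb : ∀ δ : ℝ, 0 < δ → ∀ n, ∀ z ∈ {z : ℂ | δ < z.im},
      ‖(p n : ℂ) * (I / (z - lam n))‖ ≤ p n * δ⁻¹ := by
    intro δ hδ n z hz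
    have h1 : δ ≤ ‖z - lam n‖ := by
      have := Complex.abs_im_le_norm (z - lam n)
      simp at this
      have h2 := le_abs_self z.im
      have : δ < z.im := hz
      linarith
    rw [norm_mul, norm_div, Complex.norm_I, Complex.norm_real, Real.norm_of_nonneg (hp n), one_div]
    have := hp n
    gcongr
  refine ⟨fun z => ∑' n, (p n : ℂ) * (I / (z - lam n)), ?_, ?_⟩
  · intro z hz
    have hz : 0 < z.im := hz
    have hop : IsOpen {w : ℂ | z.im / 2 < w.im} := isOpen_lt continuous_const Complex.continuous_im
    have := differentiableOn_tsum_of_summable_norm (hs.mul_right (z.im/2)⁻¹)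
      (F := fun n w => (p n : ℂ) * (I / (w - lam n))) (U := {w : ℂ | z.im / 2 < w.im}) ?_ hop
      (hb (z.im / 2) (by linarith))
    · exact (this.differentiableAt (hop.mem_nhds (by
        change z.im / 2 < z.im; linarith))).differentiableWithinAt
    · intro n w hw
      have hw : z.im / 2 < w.im := hw
      have := hne w (by linarith) n
      apply DifferentiableAt.differentiableWithinAt
      fun_prop (disch := assumption)
  · intro z hz
    have hsum : Summable (fun n => (p n : ℂ) * (I / (z - lam n))) := by
      refine Summable.of_norm_bounded (hs.mul_right (z.im/2)⁻¹) fun n => ?_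
      exact hb (z.im / 2) (by linarith) n z (by change z.im / 2 < z.im; linarith)
    refine ⟨?_, hsum.hasSum⟩
    simp only
    rw [Complex.re_tsum hsum]
    refine tsum_nonneg fun n => ?_
    have : 0 ≤ (I / (z - lam n)).re := by
      rw [Complex.div_re]
      simp
      exact div_nonneg hz.le (Complex.normSq_nonneg _)
    simp only [Complex.re_ofReal_mul]
    exact mul_nonneg (hp n) this

lemma kr_one_add (g : ℂ) (h : 0 ≤ g.re) : 1 ≤ ‖1 + g‖ ∧ ‖g‖ ≤ ‖1 + g‖ := by
  constructor
  · have := Complex.abs_re_le_norm (1 + g)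
    simp at this
    have := le_abs_self (1 + g.re)
    linarith
  · rw [← sq_le_sq₀ (norm_nonneg _) (norm_nonneg _)]
    rw [Complex.sq_norm, Complex.sq_norm, Complex.normSq_apply, Complex.normSq_apply]
    simp
    nlinarith

lemma kr_Phi (f : ℂ → ℂ) (lam : ℕ → ℝ) (c : ℕ → ℂ) (hf : Differentiable ℂ f)
    (h0 : ∀ z : ℂ, 0 < z.im → f z ≠ 0) (hc : Summable (fun n => ‖c n‖))
    (hs : ∀ z : ℂ, 0 < z.im → 1 / f z = ∑' n, c n / (z - lam n)) :
    ∃ Φ : ℂ → ℂ, DifferentiableOn ℂ Φ {z | 0 < z.im} ∧ ∀ z : ℂ, 0 < z.im →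
      1 ≤ ‖Φ z‖ ∧ ‖f z‖ ≤ ‖Φ z‖ := by
  have key : ∀ q : ℕ → ℝ, (∀ n, |q n| ≤ ‖c n‖) → Summable (fun n => max (q n) 0) := by
    intro q hq
    refine Summable.of_norm_bounded hc fun n => ?_
    rw [Real.norm_of_nonneg (le_max_right _ _)]
    exact max_le ((le_abs_self _).trans (hq n)) (norm_nonneg _)
  obtain ⟨g1, d1, k1⟩ := kr_G (fun n => max (c n).re 0) lam (fun n => le_max_right _ _)
    (key _ fun n => Complex.abs_re_le_norm _)
  obtain ⟨g2, d2, k2⟩ := kr_G (fun n => max (-(c n).re) 0) lam (fun n => le_max_right _ _)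
    (key _ fun n => by rw [abs_neg]; exact Complex.abs_re_le_norm _)
  obtain ⟨g3, d3, k3⟩ := kr_G (fun n => max (c n).im 0) lam (fun n => le_max_right _ _)
    (key _ fun n => Complex.abs_im_le_norm _)
  obtain ⟨g4, d4, k4⟩ := kr_G (fun n => max (-(c n).im) 0) lam (fun n => le_max_right _ _)
    (key _ fun n => by rw [abs_neg]; exact Complex.abs_im_le_norm _)
  refine ⟨fun z => 4 * f z * ((1 + g1 z) * (1 + g2 z) * (1 + g3 z) * (1 + g4 z)), ?_, ?_⟩
  · have := hf.differentiableOn (s := {z : ℂ | 0 < z.im})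
    fun_prop
  · intro z hz
    obtain ⟨r1, s1⟩ := k1 z hz
    obtain ⟨r2, s2⟩ := k2 z hz
    obtain ⟨r3, s3⟩ := k3 z hz
    obtain ⟨r4, s4⟩ := k4 z hz
    have hsum := ((s1.sub s2).mul_left (-I)).add (s3.sub s4)
    have e : 1 / f z = -I * (g1 z - g2 z) + (g3 z - g4 z) := by
      rw [hs z hz, ← hsum.tsum_eq]
      congr 1
      funext n
      have m : ∀ x : ℝ, max x 0 - max (-x) 0 = x := by
        intro x
        rcases le_total x 0 with h | h
        · rw [max_eq_right h, max_eq_left (by linarith)]; ring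
        · rw [max_eq_left h, max_eq_right (by linarith)]; ring
      have m1 : ((max (c n).re 0 : ℝ) : ℂ) - (max (-(c n).re) 0 : ℝ) = ((c n).re : ℂ) := by
        rw [← Complex.ofReal_sub, m]
      have m2 : ((max (c n).im 0 : ℝ) : ℂ) - (max (-(c n).im) 0 : ℝ) = ((c n).im : ℂ) := by
        rw [← Complex.ofReal_sub, m]
      rw [← sub_mul, ← sub_mul, m1, m2]
      nth_rw 1 [← Complex.re_add_im (c n)]
      ring_nf
      simp only [Complex.I_sq]
      ring
    obtain ⟨a1, b1⟩ := kr_one_add _ r1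
    obtain ⟨a2, b2⟩ := kr_one_add _ r2
    obtain ⟨a3, b3⟩ := kr_one_add _ r3
    obtain ⟨a4, b4⟩ := kr_one_add _ r4
    have hn : ‖1 / f z‖ ≤ ‖g1 z‖ + ‖g2 z‖ + (‖g3 z‖ + ‖g4 z‖) := by
      rw [e]
      refine (norm_add_le _ _).trans ?_
      rw [norm_mul, norm_neg, Complex.norm_I, one_mul]
      exact add_le_add (norm_sub_le _ _) (norm_sub_le _ _)
    simp only [norm_mul]
    set x1 := ‖1 + g1 z‖
    set x2 := ‖1 + g2 z‖
    set x3 := ‖1 + g3 z‖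
    set x4 := ‖1 + g4 z‖
    have p12 : 1 ≤ x1 * x2 := one_le_mul_of_one_le_of_one_le a1 a2
    have p123 : 1 ≤ x1 * x2 * x3 := one_le_mul_of_one_le_of_one_le p12 a3
    have p1234 : 1 ≤ x1 * x2 * x3 * x4 := one_le_mul_of_one_le_of_one_le p123 a4
    have q1 : x1 * x2 ≤ x1 * x2 * x3 * x4 := by
      rw [mul_assoc (x1 * x2)]
      exact le_mul_of_one_le_right (by positivity) (one_le_mul_of_one_le_of_one_le a3 a4)
    have c1 : x1 ≤ x1 * x2 := le_mul_of_one_le_right (by positivity) a2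
    have c2 : x2 ≤ x1 * x2 := le_mul_of_one_le_left (by positivity) a1
    have c3 : x3 ≤ x1 * x2 * x3 := le_mul_of_one_le_left (by positivity) p12
    have c3' : x1 * x2 * x3 ≤ x1 * x2 * x3 * x4 := le_mul_of_one_le_right (by positivity) a4
    have c4 : x4 ≤ x1 * x2 * x3 * x4 := le_mul_of_one_le_left (by positivity) p123
    have n4 : ‖(4 : ℂ)‖ = 4 := by simp
    rw [n4]
    have hfp : 0 < ‖f z‖ := norm_pos_iff.2 (h0 z hz)
    constructor
    · rw [norm_div, norm_one, div_le_iff₀ hfp] at hn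
      refine hn.trans ?_
      have : ‖g1 z‖ + ‖g2 z‖ + (‖g3 z‖ + ‖g4 z‖) ≤ 4 * (x1 * x2 * x3 * x4) := by linarith
      calc _ ≤ 4 * (x1 * x2 * x3 * x4) * ‖f z‖ := by gcongr
        _ = _ := by ring
    · nlinarith

lemma kr_harnack (Φ : ℂ → ℂ) (hd : DifferentiableOn ℂ Φ {z | 0 < z.im})
    (h1 : ∀ z : ℂ, 0 < z.im → 1 ≤ ‖Φ z‖) (s : ℝ) (hs : 1 ≤ s) :
    Real.log ‖Φ (s * I)‖ ≤ 4 * s * Real.log ‖Φ I‖ := by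
  have hop : IsOpen {z : ℂ | 0 < z.im} := isOpen_lt continuous_const Complex.continuous_im
  have hsub : ∀ z ∈ Metric.closedBall ((s : ℂ) * I) (s - 1 / 2), 0 < z.im := by
    intro z hz
    rw [mem_closedBall_iff_norm] at hz
    have := (Complex.abs_im_le_norm _).trans hz
    simp at this
    rw [abs_le] at this
    linarith
  have hh : InnerProductSpace.HarmonicOnNhd (fun z => Real.log ‖Φ z‖)
      (Metric.closedBall ((s : ℂ) * I) (s - 1 / 2)) := by
    intro z hz
    refine AnalyticAt.harmonicAt_log_norm (hd.analyticAt (hop.mem_nhds (hsub z hz))) ?_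
    have := h1 z (hsub z hz)
    rw [← norm_pos_iff]; linarith
  have hdist : ‖I - (s : ℂ) * I‖ = s - 1 := by
    rw [show I - (s : ℂ) * I = ((1 - s : ℝ) : ℂ) * I by push_cast; ring, norm_mul, Complex.norm_I,
      Complex.norm_real, Real.norm_eq_abs, abs_of_nonpos (by linarith)]
    ring
  have hw : I ∈ Metric.ball ((s : ℂ) * I) (s - 1 / 2) := by
    rw [mem_ball_iff_norm, hdist]; linarith
  have e1 := hh.circleAverage_re_herglotzRieszKernel_smul hw
  have habs : |s - 1 / 2| = s - 1 / 2 := abs_of_nonneg (by linarith)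
  have e2 := InnerProductSpace.HarmonicOnNhd.circleAverage_eq (R := s - 1 / 2) (by rw [habs]; exact hh)
  set k := (s - 1 / 2 - (s - 1)) / (s - 1 / 2 + (s - 1)) with hk
  have hkpos : 0 ≤ k := by apply div_nonneg <;> linarith
  have hcont : ContinuousOn (fun z => Real.log ‖Φ z‖) (Metric.sphere ((s : ℂ) * I) (s - 1 / 2)) := 
    (hh.continuousOn).mono Metric.sphere_subset_closedBall
  have e3 : k * Real.log ‖Φ (s * I)‖ ≤ Real.log ‖Φ I‖ := by
    rw [← e1, ← e2, ← smul_eq_mul, ← Real.circleAverage_fun_smul]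
    refine Real.circleAverage_mono ?_ ?_ ?_
    · apply ContinuousOn.circleIntegrable (by linarith)
      fun_prop
    · apply ContinuousOn.circleIntegrable (by linarith)
      refine ContinuousOn.smul ?_ hcont
      refine Complex.continuous_re.comp_continuousOn ?_
      rw [herglotzRieszKernel_fun_def]
      refine ContinuousOn.div (by fun_prop) (by fun_prop) ?_
      intro z hz h
      rw [mem_sphere_iff_norm] at hz
      have : z = I := by linear_combination h
      rw [this, hdist] at hz
      linarith
    · intro z hz
      rw [habs] at hz
      have hl := le_re_herglotzRieszKernel hz hw
      rw [hdist] at hl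
      have hpos : 0 ≤ Real.log ‖Φ z‖ :=
        Real.log_nonneg (h1 z (hsub z (Metric.sphere_subset_closedBall hz)))
      simp only [smul_eq_mul, Pi.smul_apply', Function.comp, herglotzRieszKernel_def]
      exact mul_le_mul_of_nonneg_right hl hpos
  have hI : 0 ≤ Real.log ‖Φ I‖ := Real.log_nonneg (h1 _ (by simp))
  rw [hk, div_mul_eq_mul_div, div_le_iff₀ (by linarith)] at e3
  nlinarith

lemma kr_cayley_im (w : ℂ) (hw : ‖w‖ < 1) : 0 < (I * ((1 + w) / (1 - w))).im := by
  have h1 : 1 - w ≠ 0 := by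
    intro h
    have : w = 1 := by linear_combination -h
    rw [this] at hw; simp at hw
  have h2 : 0 < Complex.normSq (1 - w) := Complex.normSq_pos.2 h1
  have h3 : Complex.normSq w < 1 := by
    rw [Complex.normSq_eq_norm_sq]
    have := norm_nonneg w
    nlinarith
  rw [Complex.I_mul_im, Complex.div_re, ← add_div]
  apply div_pos _ h2
  rw [Complex.normSq_apply] at h3
  simp
  nlinarith

lemma kr_cayley_arctan (t : ℝ) : circleMap 0 1 (2 * Real.arctan t + Real.pi) ≠ 1 ∧
    I * ((1 + circleMap 0 1 (2 * Real.arctan t + Real.pi)) /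
      (1 - circleMap 0 1 (2 * Real.arctan t + Real.pi))) = t := by
  set a := Real.arctan t with ha
  have hc : Real.cos a ≠ 0 := (Real.cos_arctan_pos t).ne'
  have ht : Real.sin a = t * Real.cos a := by
    rw [← Real.tan_mul_cos hc, Real.tan_arctan]
  have hsc := Real.sin_sq_add_cos_sq a
  have e : circleMap 0 1 (2 * a + Real.pi) =
      -((Real.cos a : ℂ) + Real.sin a * I) ^ 2 := by
    rw [circleMap_zero]
    push_cast
    rw [one_mul, add_mul, Complex.exp_add, Complex.exp_pi_mul_I, ← Complex.exp_mul_I, ← Complex.exp_nat_mul]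
    push_cast
    rw [mul_neg_one]
    congr 2
    ring
  have hC : (Real.cos a : ℂ) ≠ 0 := by exact_mod_cast hc
  have hS : (Real.sin a : ℂ) = t * Real.cos a := by exact_mod_cast ht
  have hSC : (Real.sin a : ℂ) ^ 2 + (Real.cos a : ℂ) ^ 2 = 1 := by exact_mod_cast hsc
  have e1 : 1 - circleMap 0 1 (2 * a + Real.pi) = 2 * Real.cos a * (Real.cos a + Real.sin a * I) := by
    rw [e, ← hSC]
    linear_combination (Real.sin a : ℂ) ^ 2 * Complex.I_sq
  have e2 : 1 + circleMap 0 1 (2 * a + Real.pi) =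
      - 2 * Real.sin a * I * (Real.cos a + Real.sin a * I) := by
    rw [e, ← hSC]
    linear_combination (Real.sin a : ℂ) ^ 2 * Complex.I_sq
  have h3 : (Real.cos a : ℂ) + Real.sin a * I ≠ 0 := by
    rw [Complex.ofReal_cos, Complex.ofReal_sin, ← Complex.exp_mul_I]
    exact Complex.exp_ne_zero _
  constructor
  · intro h
    rw [h, sub_self] at e1
    exact mul_ne_zero (mul_ne_zero two_ne_zero hC) h3 e1.symm
  · rw [e1, e2, mul_div_mul_right _ _ h3, hS]
    field_simp
    linear_combination (-(t : ℂ)) * Complex.I_sq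

lemma kr_A (Φ : ℂ → ℂ) (hd : DifferentiableOn ℂ Φ {z | 0 < z.im})
    (h1 : ∀ z : ℂ, 0 < z.im → 1 ≤ ‖Φ z‖) (ψ : ℂ → ℝ) (hψ : Continuous ψ) 
    (hle : ∀ z : ℂ, 0 < z.im → ψ z ≤ Real.log ‖Φ z‖) (R : ℝ) (hR : 0 < R) :
    ∫⁻ t : ℝ, ENNReal.ofReal (1 / (1 + t ^ 2)) * ENNReal.ofReal (ψ (R * t)) ≤
      ENNReal.ofReal (Real.pi * Real.log ‖Φ (R * I)‖) := by
  have hop : IsOpen {z : ℂ | 0 < z.im} := isOpen_lt continuous_const Complex.continuous_im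
  set φ : ℂ → ℂ := fun w => R * (I * ((1 + w) / (1 - w))) with hφ
  have him : ∀ w : ℂ, ‖w‖ < 1 → 0 < (φ w).im := by
    intro w hw
    rw [hφ]; simp only [Complex.im_ofReal_mul]
    exact mul_pos hR (kr_cayley_im w hw)
  have hφd : ∀ w : ℂ, w ≠ 1 → DifferentiableAt ℂ φ w := by
    intro w hw
    have : 1 - w ≠ 0 := sub_ne_zero.2 hw.symm
    rw [hφ]
    fun_prop (disch := assumption)
  have hne1 : ∀ w : ℂ, ‖w‖ < 1 → w ≠ 1 := by
    rintro w hw rfl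
    simp at hw
  -- the bound for each radius
  have hr : ∀ r : ℝ, 0 < r → r < 1 →
      ∫⁻ θ in Set.Ioo 0 (2 * Real.pi), ENNReal.ofReal (ψ (φ (circleMap 0 r θ))) ≤
        ENNReal.ofReal (2 * Real.pi * Real.log ‖Φ (R * I)‖) := by
    intro r hr0 hr1
    have hball : ∀ w ∈ Metric.closedBall (0 : ℂ) |r|, ‖w‖ < 1 := by
      intro w hw
      rw [abs_of_pos hr0, mem_closedBall_zero_iff] at hw
      linarith
    have han : AnalyticOnNhd ℂ (fun w => Φ (φ w)) (Metric.closedBall 0 |r|) := by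
      have hdo : DifferentiableOn ℂ (fun w => Φ (φ w)) (Metric.ball 0 1) := by
        intro w hw
        rw [mem_ball_zero_iff] at hw
        have := (hd.differentiableAt (hop.mem_nhds (him w hw))).comp w (hφd w (hne1 w hw))
        exact this.differentiableWithinAt
      refine (hdo.analyticOnNhd Metric.isOpen_ball).mono ?_
      intro w hw
      rw [mem_ball_zero_iff]
      exact hball w hw
    have hmv := han.circleAverage_log_norm_of_ne_zero (by
      intro w hw
      have := h1 _ (him w (hball w hw))
      rw [← norm_pos_iff]; linarith)
    have hφ0 : φ 0 = R * I := by simp [hφ]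
    rw [hφ0, Real.circleAverage_def, smul_eq_mul, inv_mul_eq_iff_eq_mul₀ (by positivity),
      intervalIntegral.integral_of_le (by positivity), ← integral_Ioc_eq_integral_Ioo.symm] at hmv
    have hpos : ∀ θ, 0 ≤ Real.log ‖Φ (φ (circleMap 0 r θ))‖ := by
      intro θ
      exact Real.log_nonneg (h1 _ (him _ (by simp [abs_of_pos hr0, hr1])))
    have hint : IntegrableOn (fun θ => Real.log ‖Φ (φ (circleMap 0 r θ))‖)
        (Set.Ioo 0 (2 * Real.pi)) := by
      have hc : ContinuousOn (fun w => Real.log ‖Φ (φ w)‖) (Metric.closedBall 0 |r|) := by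
        refine ContinuousOn.log han.continuousOn.norm ?_
        intro w hw
        have := h1 _ (him w (hball w hw))
        linarith
      have : Continuous (fun θ => Real.log ‖Φ (φ (circleMap 0 r θ))‖) := by
        refine hc.comp_continuous (continuous_circleMap 0 r) ?_
        intro θ
        simp
      exact (this.integrableOn_Icc).mono_set Set.Ioo_subset_Icc_self
    rw [← hmv, ofReal_integral_eq_lintegral_ofReal hint (Eventually.of_forall hpos)]
    refine lintegral_mono fun θ => ENNReal.ofReal_le_ofReal ?_
    exact hle _ (him _ (by simp [abs_of_pos hr0, hr1]))
  -- the limit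
  have hmeas : Measurable φ := by rw [hφ]; fun_prop
  have hlim : ∫⁻ θ in Set.Ioo 0 (2 * Real.pi), ENNReal.ofReal (ψ (φ (circleMap 0 1 θ))) ≤
        ENNReal.ofReal (2 * Real.pi * Real.log ‖Φ (R * I)‖) := by
    set r : ℕ → ℝ := fun n => 1 - 1 / ((n : ℝ) + 2) with hrdef
    have hrt : Tendsto r atTop (nhds 1) := by
      have := tendsto_one_div_add_atTop_nhds_zero_nat (𝕜 := ℝ)
      have h2 := (tendsto_add_atTop_iff_nat 1).2 this
      have h3 := h2.const_sub 1
      rw [sub_zero] at h3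
      refine h3.congr fun n => ?_
      rw [hrdef]; push_cast; ring
    have hr01 : ∀ n, 0 < r n ∧ r n < 1 := by
      intro n
      have : (0:ℝ) < (n : ℝ) + 2 := by positivity
      have h4 : 1 / ((n : ℝ) + 2) < 1 := by
        rw [div_lt_one this]; linarith [n.cast_nonneg (α := ℝ)]
      have h5 : 0 < 1 / ((n : ℝ) + 2) := by positivity
      constructor <;> simp only [hrdef] <;> linarith
    calc _ = ∫⁻ θ in Set.Ioo 0 (2 * Real.pi),
          liminf (fun n => ENNReal.ofReal (ψ (φ (circleMap 0 (r n) θ)))) atTop := by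
          refine setLIntegral_congr_fun measurableSet_Ioo fun θ hθ => ?_
          have hw1 : circleMap 0 1 θ ≠ 1 := by
            intro h
            rw [circleMap_zero, Complex.ofReal_one, one_mul, Complex.exp_eq_one_iff] at h
            obtain ⟨n, hn⟩ := h
            have hn' : (θ : ℂ) = ((n * (2 * Real.pi) : ℝ) : ℂ) := by
              have := mul_right_cancel₀ Complex.I_ne_zero
                (hn.trans (show (n : ℂ) * (2 * Real.pi * I) = ((n * (2 * Real.pi) : ℝ) : ℂ) * I by
                  push_cast; ring))
              exact this
            have hn2 : θ = n * (2 * Real.pi) := by exact_mod_cast hn'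
            obtain ⟨ha, hb⟩ := hθ
            rw [hn2] at ha hb
            have hp : 0 < 2 * Real.pi := by positivity
            have hn0 : (0 : ℝ) < n := by
              by_contra hcon
              push Not at hcon
              nlinarith
            have hn1 : (n : ℝ) < 1 := by
              by_contra hcon
              push Not at hcon
              nlinarith
            have : 0 < n := by exact_mod_cast hn0
            have : n < 1 := by exact_mod_cast hn1
            omega
          symm
          apply Tendsto.liminf_eq
          refine (ENNReal.continuous_ofReal.tendsto _).comp ?_
          refine (hψ.tendsto _).comp ?_
          refine ((hφd _ hw1).continuousAt.tendsto).comp ?_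
          have : Continuous (fun s : ℝ => circleMap 0 s θ) := by
            simp only [circleMap]; fun_prop
          exact (this.tendsto 1).comp hrt
      _ ≤ liminf (fun n => ∫⁻ θ in Set.Ioo 0 (2 * Real.pi),
            ENNReal.ofReal (ψ (φ (circleMap 0 (r n) θ)))) atTop := by
          refine lintegral_liminf_le fun n => ?_
          exact ENNReal.measurable_ofReal.comp (hψ.measurable.comp (hmeas.comp
            (continuous_circleMap 0 (r n)).measurable))
      _ ≤ liminf (fun n : ℕ => ENNReal.ofReal (2 * Real.pi * Real.log ‖Φ (R * I)‖)) atTop :=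
          liminf_le_liminf (Eventually.of_forall fun n => hr _ (hr01 n).1 (hr01 n).2)
      _ = _ := liminf_const _
  have himg : (fun t : ℝ => 2 * Real.arctan t + Real.pi) '' Set.univ = Set.Ioo 0 (2 * Real.pi) := by
    ext θ
    simp only [Set.image_univ, Set.mem_range, Set.mem_Ioo]
    constructor
    · rintro ⟨t, rfl⟩
      have := Real.neg_pi_div_two_lt_arctan t
      have := Real.arctan_lt_pi_div_two t
      constructor <;> linarith
    · rintro ⟨ha, hb⟩
      refine ⟨Real.tan ((θ - Real.pi) / 2), ?_⟩
      rw [Real.arctan_tan (by linarith) (by linarith)]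
      ring
  have hcv := lintegral_image_eq_lintegral_abs_deriv_mul (s := Set.univ)
    (f := fun t : ℝ => 2 * Real.arctan t + Real.pi) (f' := fun t => 2 * (1 / (1 + t ^ 2)))
    MeasurableSet.univ
    (fun t _ => (((Real.hasDerivAt_arctan t).const_mul 2).add_const _).hasDerivWithinAt)
    (by
      intro a _ b _ h
      have h : 2 * Real.arctan a + Real.pi = 2 * Real.arctan b + Real.pi := h
      exact Real.arctan_injective (by linarith))
    (fun θ => ENNReal.ofReal (ψ (φ (circleMap 0 1 θ))))
  rw [himg, Measure.restrict_univ] at hcv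
  rw [hcv] at hlim
  have h2 : ∀ t : ℝ, ENNReal.ofReal |2 * (1 / (1 + t ^ 2))| *
      ENNReal.ofReal (ψ (φ (circleMap 0 1 (2 * Real.arctan t + Real.pi)))) =
      2 * (ENNReal.ofReal (1 / (1 + t ^ 2)) * ENNReal.ofReal (ψ (R * t))) := by
    intro t
    rw [hφ]
    simp only
    rw [(kr_cayley_arctan t).2, abs_of_nonneg (by positivity), ENNReal.ofReal_mul (by norm_num),
      ENNReal.ofReal_ofNat, mul_assoc]
  simp only [h2] at hlim
  rw [lintegral_const_mul' _ _ (by simp), mul_assoc 2, ENNReal.ofReal_mul (by norm_num),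
    ENNReal.ofReal_ofNat] at hlim
  exact (ENNReal.mul_le_mul_iff_right (by simp) (by simp)).1 hlim

lemma kr_upper (f : ℂ → ℂ) (lam : ℕ → ℝ) (c : ℕ → ℂ) (hf : Differentiable ℂ f)
    (h0 : ∀ z : ℂ, 0 < z.im → f z ≠ 0) (hc : Summable (fun n => ‖c n‖))
    (hs : ∀ z : ℂ, 0 < z.im → 1 / f z = ∑' n, c n / (z - lam n)) :
    ∃ C : ℝ, 0 ≤ C ∧ ∀ R u : ℝ, 1 ≤ R → 0 ≤ u → u ≤ 1 →
      ∫⁻ t : ℝ, ENNReal.ofReal (1 / (1 + t ^ 2)) *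
        ENNReal.ofReal (Real.posLog ‖f (R * t + R * u * I)‖) ≤ ENNReal.ofReal (C * R) := by
  obtain ⟨Φ, hd, hΦ⟩ := kr_Phi f lam c hf h0 hc hs
  have hI : 0 ≤ Real.log ‖Φ I‖ := Real.log_nonneg (hΦ _ (by simp)).1
  refine ⟨Real.pi * (8 * Real.log ‖Φ I‖), by positivity, ?_⟩
  intro R u hR hu hu1
  have him : ∀ z : ℂ, 0 < z.im → 0 < (z + R * u * I).im := by
    intro z hz
    simp
    positivity
  refine (kr_A (fun z => Φ (z + R * u * I)) ?_ (fun z hz => (hΦ _ (him z hz)).1)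
    (fun z => Real.posLog ‖f (z + R * u * I)‖) ?_ ?_ R (by linarith)).trans ?_
  · exact hd.comp (by fun_prop) (fun z hz => him z hz)
  · have := hf.continuous
    have h2 := Real.continuous_posLog
    fun_prop
  · intro z hz
    obtain ⟨a, b⟩ := hΦ _ (him z hz)
    have := Real.posLog_le_posLog (norm_nonneg _) b
    rwa [Real.posLog_eq_log (x := ‖Φ (z + R * u * I)‖)
      (by rwa [abs_of_nonneg (norm_nonneg _)])] at this
  · refine ENNReal.ofReal_le_ofReal ?_
    have e : (R : ℂ) * I + R * u * I = ((R + R * u : ℝ) : ℂ) * I := by push_cast; ring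
    rw [e]
    have hRu : 0 ≤ R * u := by positivity
    have := kr_harnack Φ hd (fun z hz => (hΦ z hz).1) (R + R * u) (by linarith)
    have h3 : R * u ≤ R := by nlinarith
    have h4 : 4 * (R + R * u) * Real.log ‖Φ I‖ ≤ 8 * R * Real.log ‖Φ I‖ := by
      apply mul_le_mul_of_nonneg_right _ hI; linarith
    calc _ ≤ Real.pi * (8 * R * Real.log ‖Φ I‖) :=
          mul_le_mul_of_nonneg_left (this.trans h4) Real.pi_pos.le
      _ = _ := by ring

lemma kr_submean (g : ℂ → ℂ) (hg : Differentiable ℂ g) (a : ℂ) (r : ℝ) (hr : 0 < r) :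
    ENNReal.ofReal (2 * Real.pi * Real.posLog ‖g a‖) ≤
      ∫⁻ θ in Set.Ioo (-Real.pi) Real.pi, ENNReal.ofReal (Real.posLog ‖g (a + circleMap 0 r θ)‖) := by
  have hcont : Continuous (fun z => Real.posLog ‖g z‖) := by
    have := hg.continuous
    have h2 := Real.continuous_posLog
    fun_prop
  have hci : CircleIntegrable (fun z => Real.posLog ‖g z‖) a r :=
    hcont.continuousOn.circleIntegrable hr.le
  have key : Real.posLog ‖g a‖ ≤ Real.circleAverage (fun z => Real.posLog ‖g z‖) a r := by
    have hnn : 0 ≤ Real.circleAverage (fun z => Real.posLog ‖g z‖) a r :=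
      Real.circleAverage_nonneg_of_nonneg fun z _ => Real.posLog_nonneg
    change max 0 (Real.log ‖g a‖) ≤ _
    refine max_le hnn ?_
    by_cases h0 : g a = 0
    · simpa [h0] using hnn
    have han : AnalyticOnNhd ℂ g (Metric.closedBall a |r|) := fun z _ => hg.analyticAt z
    have hJ := han.circleAverage_log_norm hr.ne' h0
    have hsum : 0 ≤ ∑ᶠ u, (MeromorphicOn.divisor g (Metric.closedBall a |r|) u : ℝ) *
        Real.log (r * ‖a - u‖⁻¹) := by
      refine finsum_nonneg fun u => ?_
      by_cases hu : u ∈ Metric.closedBall a |r|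
      · refine mul_nonneg ?_ ?_
        · have := (MeromorphicOn.AnalyticOnNhd.divisor_nonneg han) u
          exact_mod_cast this
        · by_cases hau : a = u
          · simp [hau]
          apply Real.log_nonneg
          have hp : 0 < ‖a - u‖ := norm_pos_iff.2 (sub_ne_zero.2 hau)
          rw [abs_of_pos hr, mem_closedBall_iff_norm'] at hu
          rw [← div_eq_mul_inv, le_div_iff₀ hp]
          linarith
      · rw [Function.locallyFinsuppWithin.apply_eq_zero_of_notMem _ hu]
        simp
    have h3 : Real.log ‖g a‖ ≤ Real.circleAverage (fun z => Real.log ‖g z‖) a r := by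
      rw [hJ]; linarith
    refine h3.trans (Real.circleAverage_mono ?_ hci ?_)
    · exact MeromorphicOn.circleIntegrable_log_norm
        (fun z _ => (hg.analyticAt z).meromorphicAt)
    · intro z _
      exact le_max_right _ _
  rw [Real.circleAverage_eq_integral_add (-Real.pi), 
    intervalIntegral.integral_comp_add_right (fun θ => Real.posLog ‖g (circleMap a r θ)‖), smul_eq_mul,
    ← div_eq_inv_mul, le_div_iff₀ (by positivity), zero_add,
    show 2 * Real.pi + -Real.pi = Real.pi by ring,
    intervalIntegral.integral_of_le (by linarith [Real.pi_pos]), integral_Ioc_eq_integral_Ioo] at key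
  have hint : IntegrableOn (fun θ => Real.posLog ‖g (circleMap a r θ)‖) (Set.Ioo (-Real.pi) Real.pi) := by
    have : Continuous (fun θ => Real.posLog ‖g (circleMap a r θ)‖) :=
      hcont.comp (continuous_circleMap a r)
    exact (this.integrableOn_Icc).mono_set Set.Ioo_subset_Icc_self
  have e : ∀ θ, a + circleMap 0 r θ = circleMap a r θ := by
    intro θ; simp [circleMap]
  simp only [e]
  rw [← ofReal_integral_eq_lintegral_ofReal hint (Eventually.of_forall fun θ => Real.posLog_nonneg)]
  refine ENNReal.ofReal_le_ofReal ?_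
  linarith

lemma kr_area (g : ℂ → ℂ) (hg : Differentiable ℂ g) (a : ℂ) (ha : ‖a‖ ≤ 1 / 4) :
    ENNReal.ofReal (Real.pi / 8 * Real.posLog ‖g a‖) ≤
      ∫⁻ u in Set.Icc (-1 : ℝ) 1, ∫⁻ t in Set.Icc (-1 : ℝ) 1,
        ENNReal.ofReal (Real.posLog ‖g (t + u * I)‖) := by
  have hcont : Continuous (fun z => Real.posLog ‖g z‖) := by
    have := hg.continuous
    have h2 := Real.continuous_posLog
    fun_prop
  set F : ℂ → ENNReal := fun z => ENNReal.ofReal (Real.posLog ‖g z‖) with hF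
  have hFc : Continuous F := ENNReal.continuous_ofReal.comp hcont
  set S : Set ℂ := {z | z.re ∈ Set.Icc (-1 : ℝ) 1 ∧ z.im ∈ Set.Icc (-1 : ℝ) 1} with hS
  have hSm : MeasurableSet S :=
    (Complex.measurable_re measurableSet_Icc).inter (Complex.measurable_im measurableSet_Icc)
  have e1 : ∫⁻ z, S.indicator F z = ∫⁻ u in Set.Icc (-1 : ℝ) 1, ∫⁻ t in Set.Icc (-1 : ℝ) 1,
        F (t + u * I) := by
    rw [← (Complex.volume_preserving_equiv_real_prod.symm).lintegral_comp_emb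
      Complex.measurableEquivRealProd.symm.measurableEmbedding]
    have : ∀ p : ℝ × ℝ, S.indicator F (Complex.measurableEquivRealProd.symm p) =
        (Set.Icc (-1 : ℝ) 1 ×ˢ Set.Icc (-1 : ℝ) 1).indicator
          (fun p : ℝ × ℝ => F (p.1 + p.2 * I)) p := by
      intro p
      have hp : Complex.measurableEquivRealProd.symm p = p.1 + p.2 * I := by
        rw [Complex.measurableEquivRealProd_symm_apply]
        exact Complex.mk_eq_add_mul_I _ _
      rw [hp]
      have hiff : ((p.1 : ℂ) + p.2 * I ∈ S) ↔ p ∈ (Set.Icc (-1 : ℝ) 1 ×ˢ Set.Icc (-1 : ℝ) 1) := by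
        rw [Set.mem_prod]
        simp only [hS, Set.mem_ofPred_eq]
        simp
      by_cases h : p ∈ (Set.Icc (-1 : ℝ) 1 ×ˢ Set.Icc (-1 : ℝ) 1)
      · rw [Set.indicator_of_mem h, Set.indicator_of_mem (hiff.2 h)]
      · rw [Set.indicator_of_notMem h, Set.indicator_of_notMem (fun h' => h (hiff.1 h'))]
    simp only [this]
    rw [lintegral_indicator (measurableSet_Icc.prod measurableSet_Icc), Measure.volume_eq_prod,
      ← Measure.prod_restrict, lintegral_prod_symm']
    have : Continuous (fun p : ℝ × ℝ => F (p.1 + p.2 * I)) := hFc.comp (by fun_prop)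
    exact this.measurable
  rw [← e1, ← lintegral_add_left_eq_self _ a, ← Complex.lintegral_comp_polarCoord_symm,
    polarCoord_target]
  have hmono : (Set.Ioo (1 / 4 : ℝ) (1 / 2)) ×ˢ Set.Ioo (-Real.pi) Real.pi ⊆
      Set.Ioi (0 : ℝ) ×ˢ Set.Ioo (-Real.pi) Real.pi := by
    apply Set.prod_mono _ le_rfl
    intro x hx
    have := hx.1
    simp only [Set.mem_Ioi]; linarith
  refine le_trans ?_ (lintegral_mono_set hmono)
  have hcm : ∀ p : ℝ × ℝ, Complex.polarCoord.symm p = circleMap 0 p.1 p.2 := by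
    intro p
    rw [Complex.polarCoord_symm_apply, circleMap_zero, Complex.exp_mul_I, Complex.ofReal_cos,
      Complex.ofReal_sin]
  have hstep : ∫⁻ p in (Set.Ioo (1 / 4 : ℝ) (1 / 2)) ×ˢ Set.Ioo (-Real.pi) Real.pi,
      ENNReal.ofReal (1 / 4) * F (a + circleMap 0 p.1 p.2) ≤
      ∫⁻ p in (Set.Ioo (1 / 4 : ℝ) (1 / 2)) ×ˢ Set.Ioo (-Real.pi) Real.pi,
      ENNReal.ofReal p.1 • S.indicator F (a + Complex.polarCoord.symm p) := by
    refine setLIntegral_mono' (measurableSet_Ioo.prod measurableSet_Ioo) ?_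
    rintro ⟨r, θ⟩ ⟨⟨hr1, hr2⟩, -⟩
    simp only at hr1 hr2
    have hmem : a + circleMap 0 r θ ∈ S := by
      have hn : ‖a + circleMap 0 r θ‖ ≤ 1 := by
        refine (norm_add_le _ _).trans ?_
        rw [norm_circleMap_zero, abs_of_pos (by linarith)]
        linarith
      exact ⟨abs_le.1 ((Complex.abs_re_le_norm _).trans hn),
        abs_le.1 ((Complex.abs_im_le_norm _).trans hn)⟩
    rw [hcm, Set.indicator_of_mem hmem, smul_eq_mul]
    gcongr
  refine le_trans ?_ hstep
  have hm2 : Measurable (fun p : ℝ × ℝ => F (a + circleMap 0 p.1 p.2)) := by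
    have : Continuous (fun p : ℝ × ℝ => F (a + circleMap 0 p.1 p.2)) :=
      hFc.comp (by simp only [circleMap]; fun_prop)
    exact this.measurable
  rw [Measure.volume_eq_prod, ← Measure.prod_restrict, lintegral_prod _ (hm2.const_mul _).aemeasurable]
  calc _ = ∫⁻ r in Set.Ioo (1 / 4 : ℝ) (1 / 2), ENNReal.ofReal (1 / 4) *
        ENNReal.ofReal (2 * Real.pi * Real.posLog ‖g a‖) := by
        rw [setLIntegral_const, Real.volume_Ioo, ← ENNReal.ofReal_mul (by norm_num),
          ← ENNReal.ofReal_mul (by have := Real.posLog_nonneg (x := ‖g a‖); positivity)]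
        congr 1
        ring
    _ ≤ _ := by
        refine setLIntegral_mono' measurableSet_Ioo ?_
        intro r hr
        rw [lintegral_const_mul' _ _ (by simp)]
        gcongr
        exact kr_submean g hg a r (by linarith [hr.1])

lemma kr_line (f : ℂ → ℂ) (lam : ℕ → ℝ) (c : ℕ → ℂ) (hf : Differentiable ℂ f)
    (h0 : ∀ z : ℂ, z.im ≠ 0 → f z ≠ 0) (hc : Summable (fun n => ‖c n‖))
    (hs : ∀ z : ℂ, z.im ≠ 0 → 1 / f z = ∑' n, c n / (z - lam n)) :
    ∃ C : ℝ, 0 ≤ C ∧ ∀ R u : ℝ, 1 ≤ R → u ∈ Set.Icc (-1 : ℝ) 1 →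
      ∫⁻ t : ℝ, ENNReal.ofReal (1 / (1 + t ^ 2)) *
        ENNReal.ofReal (Real.posLog ‖f (R * t + R * u * I)‖) ≤ ENNReal.ofReal (C * R) := by
  obtain ⟨C1, hC1, k1⟩ := kr_upper f lam c hf (fun z hz => h0 z hz.ne') hc (fun z hz => hs z hz.ne')
  have d2 : Differentiable ℂ (fun z => starRingEnd ℂ (f (starRingEnd ℂ z))) := by
    intro z
    have h := (hf (starRingEnd ℂ z)).conj_conj
    rw [Complex.conj_conj] at h
    exact h
  have z2 : ∀ z : ℂ, 0 < z.im → starRingEnd ℂ (f (starRingEnd ℂ z)) ≠ 0 := by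
    intro z hz
    simp only [ne_eq, map_eq_zero]
    exact h0 _ (by simp [hz.ne'])
  have c2 : Summable (fun n => ‖starRingEnd ℂ (c n)‖) := by simpa using hc
  have s2 : ∀ z : ℂ, 0 < z.im → 1 / starRingEnd ℂ (f (starRingEnd ℂ z)) =
      ∑' n, starRingEnd ℂ (c n) / (z - lam n) := by
    intro z hz
    have := hs (starRingEnd ℂ z) (by simp [hz.ne'])
    have h2 := congrArg (starRingEnd ℂ) this
    rw [Complex.conj_tsum] at h2
    simpa using h2
  obtain ⟨C2, hC2, k2⟩ := kr_upper (fun z => starRingEnd ℂ (f (starRingEnd ℂ z))) lam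
    (fun n => starRingEnd ℂ (c n)) d2 z2 c2 s2
  refine ⟨C1 + C2, by positivity, ?_⟩
  intro R u hR hu
  rcases le_total 0 u with h | h
  · refine (k1 R u hR h hu.2).trans (ENNReal.ofReal_le_ofReal ?_)
    nlinarith
  · have := k2 R (-u) hR (by linarith) (by linarith [hu.1])
    refine le_trans (le_of_eq ?_) (this.trans (ENNReal.ofReal_le_ofReal ?_))
    · congr 1
      funext t
      rw [RCLike.norm_conj]
      simp
    · nlinarith

theorem stmt1 (f : ℂ → ℂ) (lam : ℕ → ℝ) (hf : KreinClass f lam) :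
    (∃ A B : ℝ, ∀ z : ℂ, Real.log ‖f z‖ ≤ A * ‖z‖ + B) ∧
      Integrable (fun x : ℝ => logPlus ‖f (x : ℂ)‖ / (1 + x ^ 2)) := by
  obtain ⟨hd, -, hz, -, hsum, hrep⟩ := hf
  have hne : ∀ z : ℂ, z.im ≠ 0 → f z ≠ 0 := by
    intro z hzi h
    obtain ⟨n, rfl⟩ := (hz z).1 h
    simp at hzi
  obtain ⟨C, hC, hl⟩ := kr_line f lam (fun n => 1 / deriv f (lam n)) hd hne
    (by simpa using hsum) (by
      intro z hzi
      rw [(hrep z (hne z hzi)).2]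
      simp only [div_div])
  constructor
  · refine ⟨128 * C, 128 * C, ?_⟩
    intro z
    have hlog : Real.log ‖f z‖ ≤ Real.posLog ‖f z‖ := le_max_right _ _
    refine hlog.trans ?_
    set R : ℝ := 4 * (1 + ‖z‖) with hR
    have hn := norm_nonneg z
    have hR1 : 1 ≤ R := by rw [hR]; linarith
    have hR0 : (R : ℂ) ≠ 0 := by
      have : R ≠ 0 := by linarith
      exact_mod_cast this
    have ha : ‖z / R‖ ≤ 1 / 4 := by
      rw [norm_div, Complex.norm_real, Real.norm_of_nonneg (by linarith), div_le_iff₀ (by linarith)]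
      rw [hR]; linarith
    have harea := kr_area (fun w => f (R * w)) (hd.comp (by fun_prop)) (z / R) ha
    have hin : ∀ u ∈ Set.Icc (-1 : ℝ) 1, ∫⁻ t in Set.Icc (-1 : ℝ) 1,
        ENNReal.ofReal (Real.posLog ‖f (R * (t + u * I))‖) ≤ 2 * ENNReal.ofReal (C * R) := by
      intro u hu
      have h1 := hl R u hR1 hu
      calc _ ≤ ∫⁻ t in Set.Icc (-1 : ℝ) 1, 2 * (ENNReal.ofReal (1 / (1 + t ^ 2)) *
              ENNReal.ofReal (Real.posLog ‖f (R * t + R * u * I)‖)) := by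
            refine setLIntegral_mono' measurableSet_Icc ?_
            intro t ht
            have e : (R : ℂ) * (t + u * I) = R * t + R * u * I := by ring
            rw [e, ← mul_assoc]
            apply le_mul_of_one_le_left (by positivity)
            rw [← ENNReal.ofReal_ofNat 2, ← ENNReal.ofReal_mul (by norm_num), ENNReal.one_le_ofReal,
              mul_one_div, le_div_iff₀ (by positivity)]
            nlinarith [ht.1, ht.2]
        _ ≤ ∫⁻ t, 2 * (ENNReal.ofReal (1 / (1 + t ^ 2)) *
              ENNReal.ofReal (Real.posLog ‖f (R * t + R * u * I)‖)) := setLIntegral_le_lintegral _ _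
        _ ≤ _ := by
            rw [lintegral_const_mul' _ _ (by simp)]
            gcongr
    have htot := harea.trans (setLIntegral_mono' measurableSet_Icc hin)
    rw [setLIntegral_const, Real.volume_Icc, mul_div_cancel₀ _ hR0, ← ENNReal.ofReal_ofNat 2,
      ← ENNReal.ofReal_mul (by norm_num), ← ENNReal.ofReal_mul (by positivity),
      ENNReal.ofReal_le_ofReal_iff (by positivity)] at htot
    have hL : 0 ≤ Real.posLog ‖f z‖ := Real.posLog_nonneg
    have hpi := Real.pi_gt_three
    have : Real.posLog ‖f z‖ ≤ 32 * (C * R) := by nlinarith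
    rw [hR] at this
    linarith
  · have h := hl 1 0 le_rfl (by simp)
    have hcont : Continuous (fun x : ℝ => logPlus ‖f (x : ℂ)‖ / (1 + x ^ 2)) := by
      have e : ∀ x : ℝ, logPlus ‖f (x : ℂ)‖ = Real.posLog ‖f (x : ℂ)‖ := fun x => max_comm _ _
      simp only [e]
      have := hd.continuous
      have h2 := Real.continuous_posLog
      refine Continuous.div (by fun_prop) (by fun_prop) ?_
      intro x; positivity
    refine ⟨hcont.aestronglyMeasurable, ?_⟩
    have hnn : ∀ x : ℝ, 0 ≤ logPlus ‖f (x : ℂ)‖ / (1 + x ^ 2) := fun x =>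
      div_nonneg (le_max_right _ _) (by positivity)
    rw [hasFiniteIntegral_iff_ofReal (Eventually.of_forall hnn)]
    refine lt_of_le_of_lt (le_trans (le_of_eq ?_) h) ENNReal.ofReal_lt_top
    congr 1
    funext x
    rw [← ENNReal.ofReal_mul (by positivity), one_div_mul_eq_div]
    congr 2
    simp only [logPlus, Real.posLog]
    rw [max_comm]
    simp
end

section
/- Let E ⊆ ℝ be a nonempty closed set, κ > 0, and let u : ℂ → ℝ be continuous on ℂ, equal to 0 on E, positive and harmonic on ℂ∖E, symmetric (u(conj z) = u(z) for all z), and satisfy u(z) ≥ κ|Im z| for all z ∈ ℂ. Let σ ≥ 0 and let f be an entire function such that for every ε > 0 there is a constant C_ε with |f(z)| ≤ C_ε e^{(σ+ε)|z|} for all z, and such that |f(x)| ≤ 1 for all x ∈ ℝ. Then for every σ₁ > σ/κ one has log|f(z)| ≤ σ₁ u(z) for all z ∈ ℂ. -/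
open Complex Filter Set

/-- The subset of `ℂ` corresponding to a subset of `ℝ`. -/
def cplx (E : Set ℝ) : Set ℂ := (fun x : ℝ => (x : ℂ)) '' E

theorem pl_aux (σ : ℝ) (hσ : 0 ≤ σ) (f : ℂ → ℂ) (hf : Differentiable ℂ f)
    (hf_growth : ∀ ε : ℝ, 0 < ε → ∃ C : ℝ, ∀ z : ℂ,
      ‖f z‖ ≤ C * Real.exp ((σ + ε) * ‖z‖))
    (hf_im : ∀ x : ℝ, ‖f (x * I)‖ ≤ 1) (z : ℂ) (hz : 0 ≤ z.re) :
    ‖f z‖ ≤ Real.exp (σ * z.re) := by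
  have key : ∀ ε : ℝ, 0 < ε → ‖f z‖ ≤ Real.exp ((σ + ε) * z.re) := by
    intro ε hε
    obtain ⟨C, hC⟩ := hf_growth ε hε
    have hn : ∀ w : ℂ, ‖f w * cexp (-((σ + ε : ℝ) : ℂ) * w)‖
        = ‖f w‖ * Real.exp (-((σ + ε) * w.re)) := by
      intro w
      rw [norm_mul, Complex.norm_exp, ← ofReal_neg, re_ofReal_mul, neg_mul]
    have h := PhragmenLindelof.right_half_plane_of_bounded_on_real
      (f := fun w => f w * cexp (-((σ + ε : ℝ) : ℂ) * w)) (C := 1) (z := z) ?_ ?_ ?_ ?_ hz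
    · simp only [hn] at h
      rw [Real.exp_neg, ← div_eq_mul_inv, div_le_one (Real.exp_pos _)] at h
      exact h
    · exact Differentiable.diffContOnCl (by fun_prop)
    · refine ⟨1, by norm_num, σ + ε, ?_⟩
      refine Asymptotics.IsBigO.of_bound C ?_
      rw [Filter.eventually_inf_principal]
      refine Filter.Eventually.of_forall fun w hw => ?_
      rw [hn, Real.rpow_one, Real.norm_of_nonneg (Real.exp_pos _).le]
      refine le_trans (mul_le_of_le_one_right (norm_nonneg _) ?_) (hC w)
      rw [Real.exp_le_one_iff]
      have : 0 < w.re := hw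
      have : 0 ≤ (σ + ε) * w.re := by positivity
      linarith
    · refine Filter.isBoundedUnder_of_eventually_le (a := C) ?_
      filter_upwards [Filter.eventually_ge_atTop 0] with x hx
      rw [hn, Real.exp_neg, ← div_eq_mul_inv, div_le_iff₀ (Real.exp_pos _)]
      simpa [abs_of_nonneg hx] using hC x
    · intro x
      rw [hn]
      simpa using hf_im x
  have ht : Tendsto (fun ε : ℝ => Real.exp ((σ + ε) * z.re)) (nhdsWithin 0 (Ioi 0))
      (nhds (Real.exp (σ * z.re))) := by
    have : Continuous (fun ε : ℝ => Real.exp ((σ + ε) * z.re)) := by fun_prop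
    simpa using (this.tendsto 0).mono_left nhdsWithin_le_nhds
  exact ge_of_tendsto ht (by filter_upwards [self_mem_nhdsWithin] with ε hε using key ε hε)

theorem stmt4 (E : Set ℝ) (hEne : E.Nonempty) (hEcl : IsClosed E)
    (κ : ℝ) (hκ : 0 < κ)
    (u : ℂ → ℝ) (hu_cont : Continuous u)
    (hu_zero : ∀ x ∈ E, u (x : ℂ) = 0)
    (hu_pos : ∀ z ∈ (cplx E)ᶜ, 0 < u z)
    (hu_harm : HarmonicOn u (cplx E)ᶜ)
    (hu_symm : ∀ z : ℂ, u (starRingEnd ℂ z) = u z)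
    (hu_low : ∀ z : ℂ, κ * |z.im| ≤ u z)
    (σ : ℝ) (hσ : 0 ≤ σ)
    (f : ℂ → ℂ) (hf : Differentiable ℂ f)
    (hf_growth : ∀ ε : ℝ, 0 < ε → ∃ C : ℝ, ∀ z : ℂ,
      ‖f z‖ ≤ C * Real.exp ((σ + ε) * ‖z‖))
    (hf_real : ∀ x : ℝ, ‖f (x : ℂ)‖ ≤ 1) :
    ∀ σ₁ : ℝ, σ / κ < σ₁ → ∀ z : ℂ, Real.log ‖f z‖ ≤ σ₁ * u z := by
  intro σ₁ hσ₁ z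
  have hmain : ‖f z‖ ≤ Real.exp (σ * |z.im|) := by
    rcases le_total 0 z.im with h | h
    · have := pl_aux σ hσ (fun w => f (I * w)) (by fun_prop)
        (fun ε hε => by
          obtain ⟨C, hC⟩ := hf_growth ε hε
          exact ⟨C, fun w => by simpa using hC (I * w)⟩)
        (fun x => by
          have h1 : I * ((x : ℂ) * I) = ((-x : ℝ) : ℂ) := by
            push_cast; linear_combination (x : ℂ) * I_mul_I
          rw [h1]; exact hf_real _) (-I * z) (by simpa using h)
      have h2 : I * (-I * z) = z := by linear_combination (-z) * I_mul_I
      simp only [h2] at this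
      simpa [abs_of_nonneg h] using this
    · have := pl_aux σ hσ (fun w => f (-I * w)) (by fun_prop)
        (fun ε hε => by
          obtain ⟨C, hC⟩ := hf_growth ε hε
          exact ⟨C, fun w => by simpa using hC (-I * w)⟩)
        (fun x => by
          have h1 : -I * ((x : ℂ) * I) = ((x : ℝ) : ℂ) := by
            linear_combination (-x : ℂ) * I_mul_I
          rw [h1]; exact hf_real _) (I * z) (by simpa using h)
      have h2 : -I * (I * z) = z := by linear_combination (-z) * I_mul_I
      simp only [h2] at this
      simpa [abs_of_nonpos h] using this
  have hu0 : 0 ≤ u z := le_trans (by positivity) (hu_low z)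
  have h3 : σ * |z.im| ≤ σ₁ * u z := by
    calc σ * |z.im| = σ / κ * (κ * |z.im|) := by field_simp
      _ ≤ σ / κ * u z := mul_le_mul_of_nonneg_left (hu_low z) (by positivity)
      _ ≤ σ₁ * u z := mul_le_mul_of_nonneg_right hσ₁.le hu0
  refine le_trans ?_ h3
  rcases eq_or_ne (‖f z‖) 0 with h | h
  · rw [h, Real.log_zero]; positivity
  · exact (Real.log_le_iff_le_exp (lt_of_le_of_ne (norm_nonneg _) h.symm)).2 hmain
end
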